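/- arXiv:1310.2783 — 5 statements merged into one kernel-verified Lean document; each statement's English description precedes it below -/
import Mathlib

section
/- For each ℓ ∈ {1, 2}, there exists a positive integer N = N(ℓ) such that for every integer n ≥ N, rx_{3,ℓ}(K_{n,n}) = 3. -/
open SimpleGraph

/-- `T` is a rainbow `S`-tree in `G` under edge-coloring `c`:
its vertices contain `S`, it is a tree, and `c` is injective on its edges. -/
def IsRainbowSTree {V β : Type*} (G : SimpleGraph V) (c : Sym2 V → β)
    (S : Set V) (T : G.Subgraph) : Prop :=
  S ⊆ T.verts ∧ T.coe.IsTree ∧ Set.InjOn c T.edgeSet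

/-- A family of `S`-trees is internally disjoint: pairwise edge-disjoint, and
the vertex sets of two distinct members meet exactly in `S`. -/
def InternallyDisjoint {V : Type*} {G : SimpleGraph V} (S : Set V)
    {ι : Type*} (T : ι → G.Subgraph) : Prop :=
  ∀ i j, i ≠ j → (T i).edgeSet ∩ (T j).edgeSet = ∅ ∧ (T i).verts ∩ (T j).verts = S

/-- The coloring `c` provides, for every set `S` of `k` vertices,
`ℓ` internally disjoint rainbow `S`-trees. -/
def HasRainbowSTrees {V β : Type*} (G : SimpleGraph V) (c : Sym2 V → β) (k ℓ : ℕ) : Prop :=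
  ∀ S : Finset V, S.card = k →
    ∃ T : Fin ℓ → G.Subgraph,
      (∀ i, IsRainbowSTree G c (S : Set V) (T i)) ∧ InternallyDisjoint (S : Set V) T

/-- The `(k,ℓ)`-rainbow index `rx_{k,ℓ}(G)`: the minimum number `t` of colors such that
some edge-coloring of `G` with `t` colors gives, for every `k`-set `S`,
`ℓ` internally disjoint rainbow `S`-trees. -/
noncomputable def rainbowIndex {V : Type*} (G : SimpleGraph V) (k ℓ : ℕ) : ℕ :=
  sInf {t : ℕ | ∃ c : Sym2 V → Fin t, HasRainbowSTrees G c k ℓ}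

section prob

open Finset

theorem colCard (n : ℕ) (r : Fin 3 → Fin n) (hr : Function.Injective r) (π : Fin 3 → Fin 3) :
    27 * #{g : Fin n → Fin 3 | ∀ k, g (r k) = π k} = 3 ^ n := by
  classical
  have h : ({g : Fin n → Fin 3 | ∀ k, g (r k) = π k} : Finset _) =
      Fintype.piFinset (fun i => if h : ∃ k, r k = i then {π h.choose} else univ) := by
    ext g
    simp only [mem_filter, mem_univ, true_and, Fintype.mem_piFinset]
    constructor
    · intro h i
      split_ifs with hi
      · have := hi.choose_spec
        rw [mem_singleton, ← h, this]
      · simp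
    · intro h k
      have h1 := h (r k)
      have hk : ∃ k', r k' = r k := ⟨k, rfl⟩
      rw [dif_pos hk, mem_singleton] at h1
      rw [h1, hr hk.choose_spec]
  rw [h, Fintype.card_piFinset]
  have h2 : ∀ i : Fin n, #(if h : ∃ k, r k = i then {π h.choose} else (univ : Finset (Fin 3)))
      = if i ∈ univ.image r then 1 else 3 := by
    intro i
    by_cases hi : ∃ k, r k = i <;> simp [hi]
  simp_rw [h2]
  rw [Finset.prod_ite, prod_const_one, one_mul, prod_const]
  have h3 : #(univ.image r) = 3 := by rw [card_image_of_injective _ hr]; simp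
  have h4 : #{x : Fin n | x ∉ univ.image r} + 3 = n := by
    have := card_compl_add_card (univ.image r)
    rw [h3, Fintype.card_fin] at this
    convert this using 3
    ext; simp
  calc _ = 3 ^ (#{x : Fin n | x ∉ univ.image r} + 3) := by ring
    _ = _ := by rw [h4]

theorem colCard' (n : ℕ) (r : Fin 3 → Fin n) (hr : Function.Injective r) (π : Fin 3 → Fin 3) :
    (#{g : Fin n → Fin 3 | ¬ ∀ k, g (r k) = π k} : ℝ) = 26 / 27 * 3 ^ n := by
  have h := colCard n r hr π
  have h2 := card_filter_add_card_filter_not (s := (univ : Finset (Fin n → Fin 3))) (fun g => ∀ k, g (r k) = π k)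
  rw [card_univ, Fintype.card_fun, Fintype.card_fin, Fintype.card_fin] at h2
  have h' : (27 : ℝ) * (#{g : Fin n → Fin 3 | ∀ k, g (r k) = π k} : ℝ) = 3 ^ n := by exact_mod_cast h
  have h2' : (#{g : Fin n → Fin 3 | ∀ k, g (r k) = π k} : ℝ) + (#{g : Fin n → Fin 3 | ¬ ∀ k, g (r k) = π k} : ℝ) = 3 ^ n := by exact_mod_cast h2
  linarith

/-- bad sets of matrices (first index is the column) -/
theorem badCard (n : ℕ) (r : Fin 3 → Fin n) (hr : Function.Injective r) (π : Fin 3 → Fin 3) (j0 : Fin n) :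
    (#{f : Fin n → Fin n → Fin 3 | ∀ j, j ≠ j0 → ¬ ∀ k, f j (r k) = π k} : ℝ)
      = (26 / 27) ^ (n - 1) * (3 ^ n) ^ n := by
  classical
  have h : ({f : Fin n → Fin n → Fin 3 | ∀ j, j ≠ j0 → ¬ ∀ k, f j (r k) = π k} : Finset _) =
      Fintype.piFinset (fun j => if j = j0 then univ else
        ({g : Fin n → Fin 3 | ¬ ∀ k, g (r k) = π k} : Finset _)) := by
    ext f
    simp only [mem_filter, mem_univ, true_and, Fintype.mem_piFinset]
    refine forall_congr' fun j => ?_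
    by_cases hj : j = j0 <;> simp [hj]
  rw [h, Fintype.card_piFinset, Nat.cast_prod]
  rw [← Finset.mul_prod_erase univ _ (mem_univ j0)]
  rw [Finset.prod_congr (g := fun _ => (26 / 27 * 3 ^ n : ℝ)) rfl]
  · rw [prod_const, card_erase_of_mem (mem_univ _), card_univ, Fintype.card_fin]
    have hn : n = (n - 1) + 1 := by have := j0.pos; omega
    simp only [if_true, card_univ, Fintype.card_fun, Fintype.card_fin, Nat.cast_pow, Nat.cast_ofNat]
    rw [mul_pow]
    generalize (3 ^ n : ℝ) = t
    rw [mul_left_comm, ← pow_succ', ← hn]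
  · intro j hj
    rw [if_neg (ne_of_mem_erase hj), colCard' n r hr π]

def BadR (n : ℕ) (f : Fin n → Fin n → Fin 3) : Prop :=
  ∃ (p : (Fin 3 → Fin n) × (Fin 3 → Fin 3) × Fin n), Function.Injective p.1 ∧ ∀ j, j ≠ p.2.2 → ¬ ∀ k, f j (p.1 k) = p.2.1 k

open Classical in
theorem badRCard (n : ℕ) :
    (#{f : Fin n → Fin n → Fin 3 | BadR n f} : ℝ) ≤ (n ^ 3 * (27 * n)) * ((26 / 27) ^ (n - 1) * (3 ^ n) ^ n) := by
  have hsub : ({f : Fin n → Fin n → Fin 3 | BadR n f} : Finset _) ⊆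
      (univ.filter (fun p : (Fin 3 → Fin n) × (Fin 3 → Fin 3) × Fin n => Function.Injective p.1)).biUnion
      (fun p => {f : Fin n → Fin n → Fin 3 | ∀ j, j ≠ p.2.2 → ¬ ∀ k, f j (p.1 k) = p.2.1 k}) := by
    intro f hf
    simp only [mem_filter, mem_univ, true_and, mem_biUnion] at hf ⊢
    exact hf
  calc (#{f : Fin n → Fin n → Fin 3 | BadR n f} : ℝ) ≤ _ :=
        Nat.cast_le.mpr ((card_le_card hsub).trans card_biUnion_le)
    _ = ∑ p ∈ univ.filter (fun p : (Fin 3 → Fin n) × (Fin 3 → Fin 3) × Fin n => Function.Injective p.1), ((26 / 27) ^ (n - 1) * (3 ^ n) ^ n : ℝ) := by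
      rw [Nat.cast_sum]
      refine sum_congr rfl fun p hp => ?_
      rw [← badCard n p.1 (mem_filter.1 hp).2 p.2.1 p.2.2]
    _ ≤ ∑ p : (Fin 3 → Fin n) × (Fin 3 → Fin 3) × Fin n, ((26 / 27) ^ (n - 1) * (3 ^ n) ^ n : ℝ) :=
      sum_le_sum_of_subset_of_nonneg (filter_subset _ _) (fun _ _ _ => by positivity)
    _ = _ := by
      rw [sum_const, card_univ, nsmul_eq_mul]
      simp only [Fintype.card_prod, Fintype.card_fun, Fintype.card_fin]
      push_cast
      norm_num

open Classical in
theorem exists_good : ∃ N : ℕ, ∀ n, N ≤ n → ∃ f : Fin n → Fin n → Fin 3, ¬ BadR n f ∧ ¬ BadR n (fun i j => f j i) := by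
  have ht := tendsto_pow_const_mul_const_pow_of_abs_lt_one 4 (r := (26/27 : ℝ)) (by rw [abs_of_pos] <;> norm_num)
  have := ht.eventually (gt_mem_nhds (show (0 : ℝ) < 1 / 100 by norm_num))
  obtain ⟨N, hN⟩ := Filter.eventually_atTop.1 this
  refine ⟨N + 1, fun n hn => ?_⟩
  by_contra! hcon
  have h1 := hN n (by omega)
  have hc := badRCard n
  set B : Finset (Fin n → Fin n → Fin 3) := {f : Fin n → Fin n → Fin 3 | BadR n f} with hB
  have hcov : (univ : Finset (Fin n → Fin n → Fin 3)) ⊆ B ∪ B.image (fun f i j => f j i) := by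
    intro f _
    rw [mem_union, mem_image]
    by_cases hf : BadR n f
    · left; simpa [hB] using hf
    · right; exact ⟨fun i j => f j i, by simpa [hB] using hcon f hf, rfl⟩
  have h2 : #(univ : Finset (Fin n → Fin n → Fin 3)) ≤ 2 * #B := by
    refine (card_le_card hcov).trans ((card_union_le _ _).trans ?_)
    have := card_image_le (s := B) (f := (fun f i j => f j i : (Fin n → Fin n → Fin 3) → _))
    omega
  rw [card_univ] at h2
  simp only [Fintype.card_fun, Fintype.card_fin] at h2
  have h2' : ((3 ^ n) ^ n : ℝ) ≤ 2 * (#B : ℝ) := by exact_mod_cast h2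
  have hpos : (0 : ℝ) < (3 ^ n) ^ n := by positivity
  have hn' : n = (n - 1) + 1 := by omega
  have hp : (26/27 : ℝ) ^ n = (26/27) ^ (n - 1) * (26 / 27) := by conv_lhs => rw [hn', pow_succ]
  rw [hp] at h1
  generalize ((3 ^ n) ^ n : ℝ) = t at *
  have h3 : (n ^ 3 * (27 * n)) * ((26 / 27) ^ (n - 1) * t) = (n ^ 4 * ((26 / 27 : ℝ) ^ (n - 1) * (26 / 27))) * (27 * 27 / 26) * t := by ring
  rw [h3] at hc
  have h4 := mul_lt_mul_of_pos_right h1 hpos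
  nlinarith

end prob

theorem tree4 {V β : Type*} (G : SimpleGraph V) (c : Sym2 V → β) (a b x e y d : V)
    (hab : G.Adj a b) (hxe : G.Adj x e) (hyd : G.Adj y d)
    (hx : x = a ∨ x = b) (hy : y = a ∨ y = b ∨ y = e)
    (h2 : a ≠ e) (h3 : a ≠ d) (h4 : b ≠ e) (h5 : b ≠ d) (h6 : e ≠ d)
    (c1 : c s(a, b) ≠ c s(x, e)) (c2 : c s(a, b) ≠ c s(y, d)) (c3 : c s(x, e) ≠ c s(y, d)) :
    ∃ T : G.Subgraph, T.verts = {a, b, e, d} ∧ T.edgeSet = {s(a, b), s(x, e), s(y, d)} ∧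
      T.coe.IsTree ∧ Set.InjOn c T.edgeSet := by
  classical
  have hne := hab.ne
  set T : G.Subgraph := (G.subgraphOfAdj hab ⊔ G.subgraphOfAdj hxe) ⊔ G.subgraphOfAdj hyd with hT
  have hv : T.verts = {a, b, e, d} := by
    rw [hT]
    ext z
    simp only [Subgraph.verts_sup, subgraphOfAdj_verts, Set.mem_union, Set.mem_insert_iff, Set.mem_singleton_iff]
    grind
  have he : T.edgeSet = {s(a, b), s(x, e), s(y, d)} := by
    rw [hT, Subgraph.edgeSet_sup, Subgraph.edgeSet_sup, edgeSet_subgraphOfAdj, edgeSet_subgraphOfAdj,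
      edgeSet_subgraphOfAdj]
    ext z
    simp only [Set.mem_union, Set.mem_insert_iff, Set.mem_singleton_iff, or_assoc]
  have hc : T.Connected := by
    refine Subgraph.connected_sup (Subgraph.connected_sup
      (Subgraph.subgraphOfAdj_connected hab).preconnected
      (Subgraph.subgraphOfAdj_connected hxe).preconnected ?_).preconnected
      (Subgraph.subgraphOfAdj_connected hyd).preconnected ?_
    · exact ⟨x, by simpa using hx, by simp⟩
    · refine ⟨y, ?_, by simp⟩
      simp only [Subgraph.verts_sup, subgraphOfAdj_verts, Set.mem_union, Set.mem_insert_iff, Set.mem_singleton_iff]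
      grind
  refine ⟨T, hv, he, ?_, ?_⟩
  · have hfin : Finite T.verts := by rw [hv]; exact Set.toFinite _
    rw [isTree_iff_connected_and_card]
    refine ⟨hc.coe, ?_⟩
    have e1 : Nat.card T.coe.edgeSet = 3 := by
      rw [Nat.card_coe_set_eq, ← Set.ncard_image_of_injective _ (Sym2.map.injective Subtype.val_injective),
        Subgraph.image_coe_edgeSet_coe, he, Set.ncard_eq_three]
      exact ⟨_, _, _, fun h => c1 (by rw [h]), fun h => c2 (by rw [h]), fun h => c3 (by rw [h]), rfl⟩
    have e2 : Nat.card T.verts = 4 := by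
      rw [Nat.card_coe_set_eq, hv]
      have : ({a, b, e, d} : Set V) = (({a, b, e, d} : Finset V) : Set V) := by simp
      rw [this, Set.ncard_coe_finset]
      simp [*]
    rw [e1, e2]
  · rw [he]
    intro p hp q hq hpq
    simp only [Set.mem_insert_iff, Set.mem_singleton_iff] at hp hq
    grind

def TwoTrees {V β : Type*} (G : SimpleGraph V) (c : Sym2 V → β) (S : Set V) : Prop :=
  ∃ T1 T2 : G.Subgraph, IsRainbowSTree G c S T1 ∧ IsRainbowSTree G c S T2 ∧
    T1.edgeSet ∩ T2.edgeSet = ∅ ∧ T1.verts ∩ T2.verts = S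

theorem caseA {V : Type*} (G : SimpleGraph V) (c : Sym2 V → Fin 3) (side : V → Bool)
  (hG : ∀ u v, G.Adj u v ↔ side u ≠ side v)
  (H : ∀ x y z : V, x ≠ y → x ≠ z → y ≠ z → side x = side y → side x = side z →
    ∀ p q r : Fin 3, ∃ w1 w2, w1 ≠ w2 ∧ side w1 ≠ side x ∧ side w2 ≠ side x ∧
      (c s(x, w1) = p ∧ c s(y, w1) = q ∧ c s(z, w1) = r) ∧
      (c s(x, w2) = p ∧ c s(y, w2) = q ∧ c s(z, w2) = r))
    (x y z : V) (hxy : x ≠ y) (hxz : x ≠ z) (hyz : y ≠ z) (s1 : side x = side y)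
    (s2 : side x = side z) : TwoTrees G c {x, y, z} := by
  obtain ⟨w1, w2, hw, a1, a2, ⟨p1, q1, r1⟩, ⟨p2, q2, r2⟩⟩ := H x y z hxy hxz hyz s1 s2 0 1 2
  have key : ∀ w, side w ≠ side x → c s(x, w) = 0 → c s(y, w) = 1 → c s(z, w) = 2 →
      ∃ T : G.Subgraph, T.verts = {w, x, y, z} ∧ T.edgeSet = {s(w, x), s(w, y), s(w, z)} ∧
      T.coe.IsTree ∧ Set.InjOn c T.edgeSet := by
    intro w hw p q r
    rw [Sym2.eq_swap] at p q r
    apply tree4 G c w x w y w z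
    · rw [hG]; exact hw
    · rw [hG]; rw [← s1]; exact hw
    · rw [hG]; rw [← s2]; exact hw
    · simp
    · simp
    · rintro rfl; exact hw s1.symm
    · rintro rfl; exact hw s2.symm
    · exact hxy
    · exact hxz
    · exact hyz
    · rw [p, q]; decide
    · rw [p, r]; decide
    · rw [q, r]; decide
  obtain ⟨T1, v1, e1, t1, i1⟩ := key w1 a1 p1 q1 r1
  obtain ⟨T2, v2, e2, t2, i2⟩ := key w2 a2 p2 q2 r2
  have n1 : w1 ≠ x := by rintro rfl; exact a1 rfl
  have n2 : w1 ≠ y := by rintro rfl; exact a1 s1.symm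
  have n3 : w1 ≠ z := by rintro rfl; exact a1 s2.symm
  have n4 : w2 ≠ x := by rintro rfl; exact a2 rfl
  have n5 : w2 ≠ y := by rintro rfl; exact a2 s1.symm
  have n6 : w2 ≠ z := by rintro rfl; exact a2 s2.symm
  refine ⟨T1, T2, ⟨?_, t1, i1⟩, ⟨?_, t2, i2⟩, ?_, ?_⟩
  · rw [v1]; exact Set.subset_insert _ _
  · rw [v2]; exact Set.subset_insert _ _
  · rw [e1, e2]
    ext t
    simp only [Set.mem_inter_iff, Set.mem_insert_iff, Set.mem_singleton_iff, Set.mem_empty_iff_false, iff_false]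
    rintro ⟨rfl | rfl | rfl, h⟩ <;> simp only [Sym2.eq_iff] at h <;> grind
  · rw [v1, v2]
    ext t
    simp only [Set.mem_inter_iff, Set.mem_insert_iff, Set.mem_singleton_iff]
    grind

theorem caseB {V : Type*} (G : SimpleGraph V) (c : Sym2 V → Fin 3) (side : V → Bool)
  (hG : ∀ u v, G.Adj u v ↔ side u ≠ side v)
  (H : ∀ x y z : V, x ≠ y → x ≠ z → y ≠ z → side x = side y → side x = side z →
    ∀ p q r : Fin 3, ∃ w1 w2, w1 ≠ w2 ∧ side w1 ≠ side x ∧ side w2 ≠ side x ∧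
      (c s(x, w1) = p ∧ c s(y, w1) = q ∧ c s(z, w1) = r) ∧
      (c s(x, w2) = p ∧ c s(y, w2) = q ∧ c s(z, w2) = r))
    (x y v : V) (hxy : x ≠ y) (s1 : side x = side y) (s2 : side x ≠ side v)
    (h3 : ∃ z, x ≠ z ∧ y ≠ z ∧ side x = side z) : TwoTrees G c {x, y, v} := by
  obtain ⟨z, hxz, hyz, s3⟩ := h3
  have hcol : ∀ a : Fin 3, ∃ p q : Fin 3, a ≠ p ∧ a ≠ q ∧ p ≠ q := by decide
  obtain ⟨p, q, ap, aq, pq⟩ := hcol (c s(v, x))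
  obtain ⟨p', q', ap', aq', pq'⟩ := hcol (c s(v, y))
  obtain ⟨w, -, -, sw, -, ⟨k1, k2, -⟩, -⟩ := H x y z hxy hxz hyz s1 s3 p q 0
  have : ∃ w', w' ≠ w ∧ side w' ≠ side x ∧ c s(y, w') = p' ∧ c s(x, w') = q' := by
    obtain ⟨w1, w2, hw, a1, a2, ⟨p1, q1, r1⟩, ⟨p2, q2, r2⟩⟩ := H x y z hxy hxz hyz s1 s3 q' p' 0
    by_cases hh : w1 = w
    · exact ⟨w2, by rw [← hh]; exact hw.symm, a2, q2, p2⟩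
    · exact ⟨w1, hh, a1, q1, p1⟩
  obtain ⟨w', hww, sw', k1', k2'⟩ := this
  have key : ∀ x y w : V, x ≠ y → side x = side y → side x ≠ side v → side w ≠ side x → 
      c s(v, x) ≠ c s(x, w) → c s(v, x) ≠ c s(y, w) → c s(x, w) ≠ c s(y, w) →
      ∃ T : G.Subgraph, T.verts = {v, x, w, y} ∧ T.edgeSet = {s(v, x), s(x, w), s(w, y)} ∧
      T.coe.IsTree ∧ Set.InjOn c T.edgeSet := by
    intro x y w hxy s1 s2 sw h1 h2 h3
    apply tree4 G c v x x w w y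
    · rw [hG]; exact s2.symm
    · rw [hG]; exact sw.symm
    · rw [hG, ← s1]; exact sw
    · simp
    · simp
    · rintro rfl; exact h1 (by rw [Sym2.eq_swap])
    · rintro rfl; exact s2 s1
    · rintro rfl; exact sw rfl
    · exact hxy
    · rintro rfl; exact sw s1.symm
    · exact h1
    · rw [Sym2.eq_swap (a := w)]; exact h2
    · rw [Sym2.eq_swap (a := w)]; exact h3
  obtain ⟨T1, v1, e1, t1, i1⟩ := key x y w hxy s1 s2 sw (by rw [k1]; exact ap) (by rw [k2]; exact aq)
    (by rw [k1, k2]; exact pq)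
  obtain ⟨T2, v2, e2, t2, i2⟩ := key y x w' hxy.symm s1.symm (s1 ▸ s2) (s1 ▸ sw')
    (by rw [k1']; exact ap') (by rw [k2']; exact aq') (by rw [k1', k2']; exact pq')
  have n1 : w ≠ x := by rintro rfl; exact sw rfl
  have n2 : w ≠ y := by rintro rfl; exact sw s1.symm
  have n3 : w ≠ v := by rintro rfl; rw [← k1, Sym2.eq_swap] at ap; exact ap rfl
  have n4 : w' ≠ x := by rintro rfl; exact sw' rfl
  have n5 : w' ≠ y := by rintro rfl; exact sw' s1.symm
  have n6 : w' ≠ v := by rintro rfl; rw [← k1', Sym2.eq_swap] at ap'; exact ap' rfl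
  have n7 : x ≠ v := by rintro rfl; exact s2 rfl
  have n8 : y ≠ v := by rintro rfl; exact s2 s1
  refine ⟨T1, T2, ⟨?_, t1, i1⟩, ⟨?_, t2, i2⟩, ?_, ?_⟩
  · rw [v1]; intro t; simp only [Set.mem_insert_iff, Set.mem_singleton_iff]; tauto
  · rw [v2]; intro t; simp only [Set.mem_insert_iff, Set.mem_singleton_iff]; tauto
  · rw [e1, e2]
    ext t
    simp only [Set.mem_inter_iff, Set.mem_insert_iff, Set.mem_singleton_iff, Set.mem_empty_iff_false, iff_false]
    rintro ⟨rfl | rfl | rfl, h⟩ <;> simp only [Sym2.eq_iff] at h <;> grind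
  · rw [v1, v2]
    ext t
    simp only [Set.mem_inter_iff, Set.mem_insert_iff, Set.mem_singleton_iff]
    grind

theorem allTrees {V : Type*} (G : SimpleGraph V) (c : Sym2 V → Fin 3) (side : V → Bool)
  (hG : ∀ u v, G.Adj u v ↔ side u ≠ side v)
  (H : ∀ x y z : V, x ≠ y → x ≠ z → y ≠ z → side x = side y → side x = side z →
    ∀ p q r : Fin 3, ∃ w1 w2, w1 ≠ w2 ∧ side w1 ≠ side x ∧ side w2 ≠ side x ∧
      (c s(x, w1) = p ∧ c s(y, w1) = q ∧ c s(z, w1) = r) ∧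
      (c s(x, w2) = p ∧ c s(y, w2) = q ∧ c s(z, w2) = r))
    (h3 : ∀ x y : V, ∃ z, x ≠ z ∧ y ≠ z ∧ side x = side z) (ℓ : ℕ) (hℓ : ℓ = 1 ∨ ℓ = 2) :
    HasRainbowSTrees G c 3 ℓ := by
  classical
  intro S hS
  have h2 : TwoTrees G c (S : Set V) := by
    obtain ⟨x, y, z, hxy, hxz, hyz, rfl⟩ := Finset.card_eq_three.1 hS
    simp only [Finset.coe_insert, Finset.coe_singleton]
    by_cases s1 : side x = side y
    · by_cases s2 : side x = side z
      · exact caseA G c side hG H x y z hxy hxz hyz s1 s2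
      · exact caseB G c side hG H x y z hxy s1 s2 (h3 x y)
    · by_cases s2 : side x = side z
      · have := caseB G c side hG H x z y hxz s2 s1 (h3 x z)
        rwa [Set.pair_comm z y] at this
      · have s3 : side y = side z := by
          cases hx : side x <;> cases hy : side y <;> cases hz : side z <;> simp_all
        have := caseB G c side hG H y z x hyz s3 (Ne.symm s1) (h3 y z)
        rwa [Set.pair_comm z x, Set.insert_comm] at this
  obtain ⟨T1, T2, r1, r2, he, hv⟩ := h2
  refine ⟨fun i => if i.val = 0 then T1 else T2, ?_, ?_⟩
  · intro i
    dsimp only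
    split_ifs
    · exact r1
    · exact r2
  · intro i j hij
    have hij' : i.val ≠ j.val := fun h => hij (Fin.ext h)
    have hi := i.isLt
    have hj := j.isLt
    dsimp only
    by_cases i0 : i.val = 0
    · have j0 : j.val ≠ 0 := by omega
      rw [if_pos i0, if_neg j0]
      exact ⟨he, hv⟩
    · have j0 : j.val = 0 := by omega
      rw [if_neg i0, if_pos j0]
      exact ⟨by rw [Set.inter_comm]; exact he, by rw [Set.inter_comm]; exact hv⟩


theorem lower (n : ℕ) (hn : 3 ≤ n) (ℓ : ℕ) (hℓ : 0 < ℓ) (t : ℕ)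
    (c : Sym2 (Fin n ⊕ Fin n) → Fin t)
    (h : HasRainbowSTrees (completeBipartiteGraph (Fin n) (Fin n)) c 3 ℓ) : 3 ≤ t := by
  classical
  let f : Fin 3 → Fin n ⊕ Fin n := fun i => Sum.inl (Fin.castLE hn i)
  have hf : Function.Injective f := fun i j hij => Fin.castLE_injective hn (Sum.inl_injective hij)
  obtain ⟨T, hT, -⟩ := h (Finset.univ.image f) (by rw [Finset.card_image_of_injective _ hf]; simp)
  obtain ⟨hS, htree, hinj⟩ := hT ⟨0, hℓ⟩
  generalize T ⟨0, hℓ⟩ = T at *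
  have hm : ∀ i, f i ∈ T.verts := fun i => hS (by simp)
  have : Nontrivial T.verts := ⟨⟨f 0, hm 0⟩, ⟨f 1, hm 1⟩, fun hh => by
    have := hf (congrArg Subtype.val hh); simp at this⟩
  obtain ⟨u, hu⟩ := htree.connected.preconnected.exists_adj_of_nontrivial ⟨f 0, hm 0⟩
  have hadj := T.adj_sub hu
  have hur : u.val.isRight := by simpa [f, completeBipartiteGraph] using hadj
  have h4 : 4 ≤ Nat.card T.verts := by
    have hsub : ((insert u.val (Finset.univ.image f) : Finset _) : Set _) ⊆ T.verts := by
      intro z hz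
      rw [Finset.mem_coe, Finset.mem_insert] at hz
      rcases hz with rfl | hz
      · exact u.2
      · exact hS hz
    have := Set.ncard_le_ncard hsub (Set.toFinite _)
    rw [Set.ncard_coe_finset, Finset.card_insert_of_notMem, Finset.card_image_of_injective _ hf] at this
    · rw [Nat.card_coe_set_eq]; simpa using this
    · intro hz
      obtain ⟨i, -, hi⟩ := Finset.mem_image.1 hz
      rw [← hi] at hur
      simp [f] at hur
  have hcard := (isTree_iff_connected_and_card.1 htree).2
  have e1 : Nat.card T.coe.edgeSet = T.edgeSet.ncard := by
      rw [Nat.card_coe_set_eq, ← Set.ncard_image_of_injective _ (Sym2.map.injective Subtype.val_injective),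
        Subgraph.image_coe_edgeSet_coe]
  have e2 : T.edgeSet.ncard ≤ t := by
    rw [← Set.InjOn.ncard_image hinj]
    have := Set.ncard_le_card (c '' T.edgeSet)
    simpa using this
  omega

theorem good_H (n : ℕ) (hn : 0 < n) (g : Fin n → Fin n → Fin 3) (hg : ¬ BadR n g) (x y z : Fin n)
    (hxy : x ≠ y) (hxz : x ≠ z) (hyz : y ≠ z) (p q r : Fin 3) :
    ∃ w1 w2, w1 ≠ w2 ∧ (g w1 x = p ∧ g w1 y = q ∧ g w1 z = r) ∧
      (g w2 x = p ∧ g w2 y = q ∧ g w2 z = r) := by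
  unfold BadR at hg
  push Not at hg
  have hi : Function.Injective ![x, y, z] := by
    intro i j
    fin_cases i <;> fin_cases j <;> simp [hxy, hxz, hyz, hxy.symm, hxz.symm, hyz.symm]
  obtain ⟨w1, -, h1⟩ := hg (![x, y, z], ![p, q, r], ⟨0, hn⟩) hi
  obtain ⟨w2, hw, h2⟩ := hg (![x, y, z], ![p, q, r], w1) hi
  exact ⟨w1, w2, hw.symm, ⟨h1 0, h1 1, h1 2⟩, ⟨h2 0, h2 1, h2 2⟩⟩

def colr {n : ℕ} (f : Fin n → Fin n → Fin 3) : Fin n ⊕ Fin n → Fin n ⊕ Fin n → Fin 3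
  | .inl i, .inr j => f i j
  | .inr j, .inl i => f i j
  | _, _ => 0

theorem colr_comm {n : ℕ} (f : Fin n → Fin n → Fin 3) (u v) : colr f u v = colr f v u := by
  cases u <;> cases v <;> rfl

theorem exists_third (n : ℕ) (hn : 3 ≤ n) (x y : Fin n) : ∃ z, x ≠ z ∧ y ≠ z := by
  have : ∃ z, z ∉ ({x, y} : Finset (Fin n)) := by
    by_contra! hcon
    have h1 : (Finset.univ : Finset (Fin n)) ⊆ {x, y} := fun z _ => hcon z
    have h2 := Finset.card_le_card h1
    have h3 := Finset.card_le_two (a := x) (b := y)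
    rw [Finset.card_univ, Fintype.card_fin] at h2
    omega
  obtain ⟨z, hz⟩ := this
  simp only [Finset.mem_insert, Finset.mem_singleton, not_or] at hz
  exact ⟨z, Ne.symm hz.1, Ne.symm hz.2⟩

theorem rx3l_Knn_eq_three (ℓ : ℕ) (hℓ : ℓ = 1 ∨ ℓ = 2) :
    ∃ N : ℕ, 0 < N ∧ ∀ n : ℕ, N ≤ n →
      rainbowIndex (completeBipartiteGraph (Fin n) (Fin n)) 3 ℓ = 3 := by
  obtain ⟨N, hN⟩ := exists_good
  refine ⟨N + 3, by omega, fun n hn => ?_⟩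
  have hn3 : 3 ≤ n := by omega
  obtain ⟨f, hf1, hf2⟩ := hN n (by omega)
  have hmem : 3 ∈ {t : ℕ | ∃ c : Sym2 (Fin n ⊕ Fin n) → Fin t,
      HasRainbowSTrees (completeBipartiteGraph (Fin n) (Fin n)) c 3 ℓ} := by
    refine ⟨Sym2.lift ⟨colr f, colr_comm f⟩, ?_⟩
    refine allTrees _ _ Sum.isLeft ?_ ?_ ?_ ℓ hℓ
    · rintro (u | u) (v | v) <;> simp [completeBipartiteGraph]
    · rintro (x | x) (y | y) (z | z) hxy hxz hyz s1 s2 p q r <;> simp at s1 s2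
      · obtain ⟨w1, w2, hw, h1, h2⟩ := good_H n (by omega) _ hf2 x y z
          (fun h => hxy (by rw [h])) (fun h => hxz (by rw [h])) (fun h => hyz (by rw [h])) p q r
        exact ⟨.inr w1, .inr w2, fun h => hw (Sum.inr_injective h), by simp, by simp, h1, h2⟩
      · obtain ⟨w1, w2, hw, h1, h2⟩ := good_H n (by omega) _ hf1 x y z
          (fun h => hxy (by rw [h])) (fun h => hxz (by rw [h])) (fun h => hyz (by rw [h])) p q r
        exact ⟨.inl w1, .inl w2, fun h => hw (Sum.inl_injective h), by simp, by simp, h1, h2⟩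
    · have hl : ∀ w : Fin n ⊕ Fin n, ∃ i : Fin n, w = .inl i ∨ w = .inr i := by
        rintro (i | i)
        · exact ⟨i, .inl rfl⟩
        · exact ⟨i, .inr rfl⟩
      intro x y
      obtain ⟨i, hi⟩ := hl x
      obtain ⟨j, hj⟩ := hl y
      obtain ⟨k, k1, k2⟩ := exists_third n hn3 i j
      rcases hi with rfl | rfl
      · refine ⟨.inl k, by simpa using k1, ?_, rfl⟩
        rcases hj with rfl | rfl
        · simpa using k2
        · simp
      · refine ⟨.inr k, by simpa using k1, ?_, rfl⟩
        rcases hj with rfl | rfl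
        · simp
        · simpa using k2
  unfold rainbowIndex
  refine le_antisymm (Nat.sInf_le hmem) (le_csInf ⟨3, hmem⟩ ?_)
  rintro t ⟨c, hc⟩
  exact lower n hn3 ℓ (by omega) t c hc
end

section
/- There exists a positive integer N such that for every integer n ≥ N there is a coloring of the edges of K_{n,n} with 3 colors such that for every set S of three vertices of K_{n,n} there exist two internally disjoint rainbow S-trees; consequently rx_{3,2}(K_{n,n}) ≤ 3 for all n ≥ N. -/
open SimpleGraph

lemma card_fiber (n : ℕ) (r : Fin 4 → Fin n) (hr : Function.Injective r) (p : Fin 4 → Fin 3) :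
    3 ^ n ≤ 81 * (Finset.univ.filter (fun f : Fin n → Fin 3 => f ∘ r = p)).card := by
  classical
  have h := Finset.card_le_card_of_injOn (s := (Finset.univ : Finset (Fin n → Fin 3)))
    (t := (Finset.univ : Finset (Fin 4 → Fin 3)) ×ˢ
      (Finset.univ.filter (fun f : Fin n → Fin 3 => f ∘ r = p)))
    (fun f => (f ∘ r, Function.extend r p f)) (by
      intro f _
      simp [Function.extend_comp hr]) (by
      intro f _ g _ h
      simp only [Prod.mk.injEq] at h
      funext x
      by_cases hx : ∃ i, r i = x
      · obtain ⟨i, rfl⟩ := hx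
        exact congrFun h.1 i
      · have := congrFun h.2 x
        rwa [Function.extend_apply' _ _ _ hx, Function.extend_apply' _ _ _ hx] at this)
  simpa using h

/-- matrices (given by columns) for which pattern `p` on rows `r` is never met -/
def badSet (n : ℕ) (r : Fin 4 → Fin n) (p : Fin 4 → Fin 3) : Finset (Fin n → Fin n → Fin 3) :=
  Fintype.piFinset (fun _ : Fin n => Finset.univ.filter (fun f : Fin n → Fin 3 => f ∘ r ≠ p))

lemma card_bad (n : ℕ) (r : Fin 4 → Fin n) (hr : Function.Injective r) (p : Fin 4 → Fin 3) :
    ((badSet n r p).card : ℝ) ≤ (80 / 81 : ℝ) ^ n * (3 ^ n) ^ n := by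
  classical
  have h1 := card_fiber n r hr p
  have h2 := Finset.card_filter_add_card_filter_not (s := (Finset.univ : Finset (Fin n → Fin 3)))
    (fun f => f ∘ r = p)
  simp only [Finset.card_univ, Fintype.card_fun, Fintype.card_fin] at h2
  have h3 : ((Finset.univ.filter (fun f : Fin n → Fin 3 => f ∘ r ≠ p)).card : ℝ)
      ≤ 80 / 81 * 3 ^ n := by
    have h1' : (3 : ℝ) ^ n ≤
      81 * ((Finset.univ.filter (fun f : Fin n → Fin 3 => f ∘ r = p)).card : ℝ) := by
      exact_mod_cast h1
    have h2' : ((Finset.univ.filter (fun f : Fin n → Fin 3 => f ∘ r = p)).card : ℝ) +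
      ((Finset.univ.filter (fun f : Fin n → Fin 3 => f ∘ r ≠ p)).card : ℝ) = 3 ^ n := by
      exact_mod_cast h2
    linarith
  rw [badSet, Fintype.card_piFinset_const, ← mul_pow]
  push_cast
  exact pow_le_pow_left₀ (by positivity) h3 n

/-- every pattern on four rows is met in some column -/
def GoodM (n : ℕ) (M : Fin n → Fin n → Fin 3) : Prop :=
  ∀ r : Fin 4 → Fin n, Function.Injective r → ∀ p : Fin 4 → Fin 3, ∃ j, ∀ i, M (r i) j = p i

lemma exists_good_s6 (n : ℕ) (hn : (n : ℝ) ^ 4 * (80 / 81 : ℝ) ^ n < 1 / 162) :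
    ∃ M : Fin n → Fin n → Fin 3, GoodM n M ∧ GoodM n (fun i j => M j i) := by
  classical
  let I : Finset ((Fin 4 → Fin n) × (Fin 4 → Fin 3)) :=
    Finset.univ.filter (fun q => Function.Injective q.1)
  let B := I.biUnion (fun q => badSet n q.1 q.2)
  let e : (Fin n → Fin n → Fin 3) → (Fin n → Fin n → Fin 3) := fun M i j => M j i
  have hI : (I.card : ℝ) ≤ n ^ 4 * 81 := by
    have : I.card ≤ n ^ 4 * 81 := by
      refine (Finset.card_le_univ _).trans ?_
      simp
    exact_mod_cast this
  have hB : (B.card : ℝ) ≤ n ^ 4 * 81 * ((80 / 81 : ℝ) ^ n * (3 ^ n) ^ n) := by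
    calc (B.card : ℝ) ≤ ∑ q ∈ I, ((badSet n q.1 q.2).card : ℝ) := by
          exact_mod_cast Finset.card_biUnion_le
      _ ≤ ∑ q ∈ I, ((80 / 81 : ℝ) ^ n * (3 ^ n) ^ n) :=
          Finset.sum_le_sum (fun q hq => card_bad n q.1 (Finset.mem_filter.1 hq).2 q.2)
      _ ≤ _ := by
          rw [Finset.sum_const, nsmul_eq_mul]
          gcongr
  have hgood : ∀ M, M ∉ B → GoodM n (e M) := by
    intro M hM r hr p
    by_contra! hc
    apply hM
    refine Finset.mem_biUnion.2 ⟨(r, p), by simp [I, hr], ?_⟩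
    rw [badSet, Fintype.mem_piFinset]
    intro j
    obtain ⟨i, hi⟩ := hc j
    simp only [Finset.mem_filter, Finset.mem_univ, true_and]
    intro h
    exact hi (congrFun h i)
  have hlt : (B ∪ B.image e).card < (Finset.univ : Finset (Fin n → Fin n → Fin 3)).card := by
    have h1 : (B ∪ B.image e).card ≤ B.card + B.card :=
      (Finset.card_union_le _ _).trans (Nat.add_le_add_left Finset.card_image_le _)
    have h2 : ((B.card + B.card : ℕ) : ℝ) < (3 ^ n) ^ n := by
      push_cast
      have : (0 : ℝ) < (3 ^ n) ^ n := by positivity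
      nlinarith
    have h3 : B.card + B.card < (3 ^ n) ^ n := by exact_mod_cast h2
    simpa using h1.trans_lt h3
  obtain ⟨M, -, hM⟩ := Finset.exists_mem_notMem_of_card_lt_card hlt
  rw [Finset.mem_union, not_or] at hM
  refine ⟨M, hgood (e M) ?_, hgood M hM.1⟩
  intro h
  exact hM.2 (Finset.mem_image.2 ⟨e M, h, rfl⟩)

lemma good_three {n : ℕ} {M : Fin n → Fin n → Fin 3} (hM : GoodM n M) (hn : 4 ≤ n)
    {x y z : Fin n} (hxy : x ≠ y) (hxz : x ≠ z) (hyz : y ≠ z) (a b c a' b' c' : Fin 3) :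
    ∃ j j', j ≠ j' ∧ (M x j = a ∧ M y j = b ∧ M z j = c) ∧
      (M x j' = a' ∧ M y j' = b' ∧ M z j' = c') := by
  obtain ⟨t, ht⟩ : ∃ t, t ∉ ({x, y, z} : Finset (Fin n)) := by
    by_contra! h
    have := Finset.card_le_card (fun t _ => h t : (Finset.univ : Finset (Fin n)) ⊆ _)
    have h3 := Finset.card_le_three (a := x) (b := y) (c := z)
    simp only [Finset.card_univ, Fintype.card_fin] at this
    omega
  simp only [Finset.mem_insert, Finset.mem_singleton, not_or] at ht
  obtain ⟨h1, h2, h3⟩ := ht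
  have hr : Function.Injective ![x, y, z, t] := by
    intro i j h
    fin_cases i <;> fin_cases j <;> simp_all [eq_comm]
  obtain ⟨j, hj⟩ := hM _ hr ![a, b, c, 0]
  obtain ⟨j', hj'⟩ := hM _ hr ![a', b', c', 1]
  refine ⟨j, j', ?_, ⟨hj 0, hj 1, hj 2⟩, ⟨hj' 0, hj' 1, hj' 2⟩⟩
  rintro rfl
  have e1 := hj 3
  have e2 := hj' 3
  simp at e1 e2
  rw [e1] at e2
  exact absurd e2 (by decide)

lemma good_two {n : ℕ} {M : Fin n → Fin n → Fin 3} (hM : GoodM n M) (hn : 4 ≤ n)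
    {x y : Fin n} (hxy : x ≠ y) (a b a' b' : Fin 3) :
    ∃ j j', j ≠ j' ∧ (M x j = a ∧ M y j = b) ∧ (M x j' = a' ∧ M y j' = b') := by
  obtain ⟨t, ht⟩ : ∃ t, t ∉ ({x, y} : Finset (Fin n)) := by
    by_contra! h
    have := Finset.card_le_card (fun t _ => h t : (Finset.univ : Finset (Fin n)) ⊆ _)
    have h3 := Finset.card_le_two (a := x) (b := y)
    simp only [Finset.card_univ, Fintype.card_fin] at this
    omega
  simp only [Finset.mem_insert, Finset.mem_singleton, not_or] at ht
  obtain ⟨j, j', h, h1, h2⟩ := good_three hM hn hxy (Ne.symm ht.1) (Ne.symm ht.2) a b 0 a' b' 0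
  exact ⟨j, j', h, ⟨h1.1, h1.2.1⟩, ⟨h2.1, h2.2.1⟩⟩

lemma eventually_small : ∃ N : ℕ, ∀ n, N ≤ n → (n : ℝ) ^ 4 * (80 / 81 : ℝ) ^ n < 1 / 162 := by
  have h := tendsto_pow_const_mul_const_pow_of_abs_lt_one 4 (r := (80 / 81 : ℝ))
    (by rw [abs_of_pos] <;> norm_num)
  exact Filter.eventually_atTop.1 (h.eventually_lt_const (by norm_num))

/-- a tree on four vertices: `0-1`, `p-2`, `q-3`. -/
def H4 (p q : Fin 4) : SimpleGraph (Fin 4) := SimpleGraph.fromEdgeSet {s(0, 1), s(p, 2), s(q, 3)}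

lemma H4_edgeSet (p q : Fin 4) (hp : p < 2) (hq : q < 3) :
    (H4 p q).edgeSet = {s(0, 1), s(p, 2), s(q, 3)} := by
  rw [H4, SimpleGraph.edgeSet_fromEdgeSet, sdiff_eq_left, Set.disjoint_left]
  intro e he
  simp only [Set.mem_insert_iff, Set.mem_singleton_iff] at he
  rcases he with rfl | rfl | rfl <;> simp
  · exact hp.ne
  · exact hq.ne

lemma H4_isTree (p q : Fin 4) (hp : p < 2) (hq : q < 3) : (H4 p q).IsTree := by
  rw [SimpleGraph.isTree_iff_connected_and_card]
  have e1 : (H4 p q).Reachable 0 1 := Adj.reachable (by simp [H4])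
  have e2 : (H4 p q).Reachable p 2 := Adj.reachable (by simp [H4, hp.ne])
  have e3 : (H4 p q).Reachable q 3 := Adj.reachable (by simp [H4, hq.ne])
  constructor
  · have h0 : ∀ i, (H4 p q).Reachable 0 i := by
      have h2 : (H4 p q).Reachable 0 2 := by
        have : p = 0 ∨ p = 1 := by clear e1 e2 e3; revert p; decide
        rcases this with rfl | rfl
        · exact e2
        · exact e1.trans e2
      have h3 : (H4 p q).Reachable 0 3 := by
        have : q = 0 ∨ q = 1 ∨ q = 2 := by clear h2 e3 e2 e1; revert q; decide
        rcases this with rfl | rfl | rfl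
        · exact e3
        · exact e1.trans e3
        · exact h2.trans e3
      intro i
      fin_cases i
      · exact Reachable.refl _
      · exact e1
      · exact h2
      · exact h3
    exact { preconnected := fun a b => (h0 a).symm.trans (h0 b) }
  · rw [H4_edgeSet p q hp hq]
    have : ({s(0, 1), s(p, 2), s(q, 3)} : Set (Sym2 (Fin 4))) =
      (({s(0, 1), s(p, 2), s(q, 3)} : Finset (Sym2 (Fin 4))) : Set (Sym2 (Fin 4))) := by simp
    rw [this, Nat.card_coe_set_eq, Set.ncard_coe_finset, Nat.card_eq_fintype_card, Fintype.card_fin]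
    clear e1 e2 e3 this
    revert p q
    decide

lemma exists_tree {V β : Type*} (G : SimpleGraph V) (c : Sym2 V → β) (p q : Fin 4)
    (hp : p < 2) (hq : q < 3) (f : Fin 4 → V) (hf : Function.Injective f)
    (h1 : G.Adj (f 0) (f 1)) (h2 : G.Adj (f p) (f 2)) (h3 : G.Adj (f q) (f 3))
    (c1 : c s(f 0, f 1) ≠ c s(f p, f 2)) (c2 : c s(f 0, f 1) ≠ c s(f q, f 3))
    (c3 : c s(f p, f 2) ≠ c s(f q, f 3)) :
    ∃ T : G.Subgraph, T.verts = Set.range f ∧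
      T.edgeSet = {s(f 0, f 1), s(f p, f 2), s(f q, f 3)} ∧ T.coe.IsTree ∧
      Set.InjOn c T.edgeSet := by
  let φ : (H4 p q).Copy G := ⟨⟨f, by
    intro a b hab
    have : s(a, b) ∈ (H4 p q).edgeSet := hab
    rw [H4_edgeSet p q hp hq] at this
    simp only [Set.mem_insert_iff, Set.mem_singleton_iff, Sym2.eq_iff] at this
    rcases this with (⟨rfl, rfl⟩ | ⟨rfl, rfl⟩) | (⟨rfl, rfl⟩ | ⟨rfl, rfl⟩) |
      (⟨rfl, rfl⟩ | ⟨rfl, rfl⟩)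
    exacts [h1, h1.symm, h2, h2.symm, h3, h3.symm]⟩, hf⟩
  have hE : φ.toSubgraph.edgeSet = {s(f 0, f 1), s(f p, f 2), s(f q, f 3)} := by
    rw [Copy.toSubgraph, Subgraph.edgeSet_map, Subgraph.edgeSet_top, H4_edgeSet p q hp hq]
    simp only [Set.image_insert_eq, Set.image_singleton]
    rfl
  refine ⟨φ.toSubgraph, ?_, hE, φ.isoToSubgraph.isTree_iff.1 (H4_isTree p q hp hq), ?_⟩
  · simp [Copy.toSubgraph]
    rfl
  · rw [hE]
    intro a ha b hb hab
    simp only [Set.mem_insert_iff, Set.mem_singleton_iff] at ha hb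
    rcases ha with rfl | rfl | rfl <;> rcases hb with rfl | rfl | rfl <;>
      first | rfl | exact absurd hab (by assumption) | exact absurd hab.symm (by assumption)

/-- three vertices joined by two stars -/
lemma two_stars {V β : Type*} (G : SimpleGraph V) (c : Sym2 V → β) (x y z w w' : V)
    (hxy : x ≠ y) (hxz : x ≠ z) (hyz : y ≠ z) (hww : w ≠ w')
    (h1 : G.Adj w x) (h2 : G.Adj w y) (h3 : G.Adj w z)
    (h1' : G.Adj w' x) (h2' : G.Adj w' y) (h3' : G.Adj w' z)
    (c1 : c s(w, x) ≠ c s(w, y)) (c2 : c s(w, x) ≠ c s(w, z)) (c3 : c s(w, y) ≠ c s(w, z))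
    (c1' : c s(w', x) ≠ c s(w', y)) (c2' : c s(w', x) ≠ c s(w', z))
    (c3' : c s(w', y) ≠ c s(w', z)) :
    ∃ T : Fin 2 → G.Subgraph,
      (∀ i, IsRainbowSTree G c ({x, y, z} : Set V) (T i)) ∧
        InternallyDisjoint ({x, y, z} : Set V) T := by
  have a1 := h1.ne
  have a2 := h2.ne
  have a3 := h3.ne
  have b1 := h1'.ne
  have b2 := h2'.ne
  have b3 := h3'.ne
  obtain ⟨T, hV, hE, hT, hc⟩ := exists_tree G c 0 0 (by decide) (by decide) ![w, x, y, z]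
    (by intro i j h; fin_cases i <;> fin_cases j <;> simp_all [eq_comm]) h1 h2 h3 c1 c2 c3
  obtain ⟨T', hV', hE', hT', hc'⟩ := exists_tree G c 0 0 (by decide) (by decide) ![w', x, y, z]
    (by intro i j h; fin_cases i <;> fin_cases j <;> simp_all [eq_comm]) h1' h2' h3' c1' c2' c3'
  have hd : T.edgeSet ∩ T'.edgeSet = ∅ := by
    rw [hE, hE', ← Set.disjoint_iff_inter_eq_empty, Set.disjoint_left]
    intro e h h'
    clear hE hE' hV hV' hT hT' hc hc' c1 c2 c3 c1' c2' c3' h1 h2 h3 h1' h2' h3' T T'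
    simp only [Set.mem_insert_iff, Set.mem_singleton_iff, Matrix.cons_val] at h h'
    rcases h with rfl | rfl | rfl <;> simp only [Sym2.eq_iff] at h' <;> grind
  have hv : T.verts ∩ T'.verts = {x, y, z} := by
    rw [hV, hV']
    ext e
    clear hE hE' hV hV' hT hT' hc hc' c1 c2 c3 c1' c2' c3' h1 h2 h3 h1' h2' h3' hd T T'
    simp [Matrix.range_cons]
    grind
  refine ⟨![T, T'], ?_, ?_⟩
  · intro i
    fin_cases i
    · exact ⟨hv ▸ Set.inter_subset_left, hT, hc⟩
    · exact ⟨hv ▸ Set.inter_subset_right, hT', hc'⟩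
  · intro i j hij
    fin_cases i <;> fin_cases j
    · exact absurd rfl hij
    · exact ⟨hd, hv⟩
    · exact ⟨(Set.inter_comm _ _).trans hd, (Set.inter_comm _ _).trans hv⟩
    · exact absurd rfl hij

/-- two vertices and a common neighbour, joined by two paths -/
lemma two_paths {V β : Type*} (G : SimpleGraph V) (c : Sym2 V → β) (x y v w w' : V)
    (hxy : x ≠ y) (hvw : v ≠ w) (hvw' : v ≠ w') (hww : w ≠ w')
    (h1 : G.Adj v x) (h2 : G.Adj x w) (h3 : G.Adj w y)
    (h1' : G.Adj v y) (h2' : G.Adj y w') (h3' : G.Adj w' x)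
    (c1 : c s(v, x) ≠ c s(x, w)) (c2 : c s(v, x) ≠ c s(w, y)) (c3 : c s(x, w) ≠ c s(w, y))
    (c1' : c s(v, y) ≠ c s(y, w')) (c2' : c s(v, y) ≠ c s(w', x))
    (c3' : c s(y, w') ≠ c s(w', x)) :
    ∃ T : Fin 2 → G.Subgraph,
      (∀ i, IsRainbowSTree G c ({x, y, v} : Set V) (T i)) ∧
        InternallyDisjoint ({x, y, v} : Set V) T := by
  have a1 := h1.ne
  have a2 := h2.ne
  have a3 := h3.ne
  have b1 := h1'.ne
  have b2 := h2'.ne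
  have b3 := h3'.ne
  obtain ⟨T, hV, hE, hT, hc⟩ := exists_tree G c 1 2 (by decide) (by decide) ![v, x, w, y]
    (by intro i j h; fin_cases i <;> fin_cases j <;> simp_all [eq_comm]) h1 h2 h3 c1 c2 c3
  obtain ⟨T', hV', hE', hT', hc'⟩ := exists_tree G c 1 2 (by decide) (by decide) ![v, y, w', x]
    (by intro i j h; fin_cases i <;> fin_cases j <;> simp_all [eq_comm]) h1' h2' h3' c1' c2' c3'
  have hd : T.edgeSet ∩ T'.edgeSet = ∅ := by
    rw [hE, hE', ← Set.disjoint_iff_inter_eq_empty, Set.disjoint_left]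
    intro e h h'
    clear hE hE' hV hV' hT hT' hc hc' c1 c2 c3 c1' c2' c3' h1 h2 h3 h1' h2' h3' T T'
    simp only [Set.mem_insert_iff, Set.mem_singleton_iff, Matrix.cons_val] at h h'
    rcases h with rfl | rfl | rfl <;> simp only [Sym2.eq_iff] at h' <;> grind
  have hv : T.verts ∩ T'.verts = {x, y, v} := by
    rw [hV, hV']
    ext e
    clear hE hE' hV hV' hT hT' hc hc' c1 c2 c3 c1' c2' c3' h1 h2 h3 h1' h2' h3' hd T T'
    simp [Matrix.range_cons]
    grind
  refine ⟨![T, T'], ?_, ?_⟩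
  · intro i
    fin_cases i
    · exact ⟨hv ▸ Set.inter_subset_left, hT, hc⟩
    · exact ⟨hv ▸ Set.inter_subset_right, hT', hc'⟩
  · intro i j hij
    fin_cases i <;> fin_cases j
    · exact absurd rfl hij
    · exact ⟨hd, hv⟩
    · exact ⟨(Set.inter_comm _ _).trans hd, (Set.inter_comm _ _).trans hv⟩
    · exact absurd rfl hij

/-- the edge coloring given by a matrix -/
def colM {n : ℕ} (M : Fin n → Fin n → Fin 3) : Sym2 (Fin n ⊕ Fin n) → Fin 3 :=
  Sym2.lift ⟨fun a b => match a, b with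
    | .inl i, .inr j => M i j
    | .inr j, .inl i => M i j
    | _, _ => 0, by
      rintro (a | a) (b | b) <;> rfl⟩

lemma colM_lr {n : ℕ} (M : Fin n → Fin n → Fin 3) (i j : Fin n) :
    colM M s(.inl i, .inr j) = M i j := rfl

lemma colM_rl {n : ℕ} (M : Fin n → Fin n → Fin 3) (i j : Fin n) :
    colM M s(.inr j, .inl i) = M i j := rfl

lemma fin3_a : ∀ x : Fin 3, x ≠ x + 1 ∧ x ≠ x + 2 ∧ x + 1 ≠ x + 2 := by decide

lemma case_LLR {n : ℕ} {M : Fin n → Fin n → Fin 3} (hM : GoodM n M) (hn : 4 ≤ n)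
    {x y v : Fin n} (hxy : x ≠ y) :
    ∃ T : Fin 2 → (completeBipartiteGraph (Fin n) (Fin n)).Subgraph,
      (∀ i, IsRainbowSTree _ (colM M) ({.inl x, .inl y, .inr v} : Set (Fin n ⊕ Fin n)) (T i)) ∧
        InternallyDisjoint ({.inl x, .inl y, .inr v} : Set (Fin n ⊕ Fin n)) T := by
  obtain ⟨w, w', hw, ⟨e1, e2⟩, e3, e4⟩ := good_two hM hn hxy (M x v + 1) (M x v + 2)
    (M y v + 2) (M y v + 1)
  have f1 := fin3_a (M x v)
  have f2 := fin3_a (M y v)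
  have g1 : v ≠ w := by rintro rfl; exact f1.1 e1
  have g2 : v ≠ w' := by rintro rfl; exact f2.1 e4
  apply two_paths (completeBipartiteGraph (Fin n) (Fin n)) (colM M) (.inl x) (.inl y) (.inr v) (.inr w) (.inr w') <;>
    first | (simp only [colM_lr, colM_rl, e1, e2, e3, e4]; tauto) | simp_all

lemma case_RRL {n : ℕ} {M : Fin n → Fin n → Fin 3} (hM : GoodM n (fun i j => M j i)) (hn : 4 ≤ n)
    {x y v : Fin n} (hxy : x ≠ y) :
    ∃ T : Fin 2 → (completeBipartiteGraph (Fin n) (Fin n)).Subgraph,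
      (∀ i, IsRainbowSTree _ (colM M) ({.inr x, .inr y, .inl v} : Set (Fin n ⊕ Fin n)) (T i)) ∧
        InternallyDisjoint ({.inr x, .inr y, .inl v} : Set (Fin n ⊕ Fin n)) T := by
  obtain ⟨w, w', hw, ⟨e1, e2⟩, e3, e4⟩ := good_two hM hn hxy (M v x + 1) (M v x + 2)
    (M v y + 2) (M v y + 1)
  have f1 := fin3_a (M v x)
  have f2 := fin3_a (M v y)
  have g1 : v ≠ w := by rintro rfl; exact f1.1 e1
  have g2 : v ≠ w' := by rintro rfl; exact f2.1 e4
  apply two_paths (completeBipartiteGraph (Fin n) (Fin n)) (colM M) (.inr x) (.inr y) (.inl v) (.inl w) (.inl w') <;>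
    first | (simp only [colM_lr, colM_rl, e1, e2, e3, e4]; tauto) | simp_all

lemma case_LLL {n : ℕ} {M : Fin n → Fin n → Fin 3} (hM : GoodM n M) (hn : 4 ≤ n)
    {x y z : Fin n} (hxy : x ≠ y) (hxz : x ≠ z) (hyz : y ≠ z) :
    ∃ T : Fin 2 → (completeBipartiteGraph (Fin n) (Fin n)).Subgraph,
      (∀ i, IsRainbowSTree _ (colM M) ({.inl x, .inl y, .inl z} : Set (Fin n ⊕ Fin n)) (T i)) ∧
        InternallyDisjoint ({.inl x, .inl y, .inl z} : Set (Fin n ⊕ Fin n)) T := by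
  obtain ⟨w, w', hw, ⟨e1, e2, e3⟩, e4, e5, e6⟩ := good_three hM hn hxy hxz hyz 0 1 2 0 1 2
  apply two_stars (completeBipartiteGraph (Fin n) (Fin n)) (colM M) (.inl x) (.inl y) (.inl z) (.inr w) (.inr w') <;>
    first | (simp only [colM_lr, colM_rl, e1, e2, e3, e4, e5, e6]; decide) | simp_all

lemma case_RRR {n : ℕ} {M : Fin n → Fin n → Fin 3} (hM : GoodM n (fun i j => M j i)) (hn : 4 ≤ n)
    {x y z : Fin n} (hxy : x ≠ y) (hxz : x ≠ z) (hyz : y ≠ z) :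
    ∃ T : Fin 2 → (completeBipartiteGraph (Fin n) (Fin n)).Subgraph,
      (∀ i, IsRainbowSTree _ (colM M) ({.inr x, .inr y, .inr z} : Set (Fin n ⊕ Fin n)) (T i)) ∧
        InternallyDisjoint ({.inr x, .inr y, .inr z} : Set (Fin n ⊕ Fin n)) T := by
  obtain ⟨w, w', hw, ⟨e1, e2, e3⟩, e4, e5, e6⟩ := good_three hM hn hxy hxz hyz 0 1 2 0 1 2
  apply two_stars (completeBipartiteGraph (Fin n) (Fin n)) (colM M) (.inr x) (.inr y) (.inr z) (.inl w) (.inl w') <;>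
    first | (simp only [colM_lr, colM_rl, e1, e2, e3, e4, e5, e6]; decide) | simp_all

theorem exists_three_coloring_Knn :
    ∃ N : ℕ, 0 < N ∧ ∀ n : ℕ, N ≤ n →
      (∃ c : Sym2 (Fin n ⊕ Fin n) → Fin 3,
        HasRainbowSTrees (completeBipartiteGraph (Fin n) (Fin n)) c 3 2) ∧
      rainbowIndex (completeBipartiteGraph (Fin n) (Fin n)) 3 2 ≤ 3 := by
  obtain ⟨N, hN⟩ := eventually_small
  refine ⟨N + 4, by omega, fun n hn => ?_⟩
  have hn4 : 4 ≤ n := by omega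
  have key : ∃ c : Sym2 (Fin n ⊕ Fin n) → Fin 3,
      HasRainbowSTrees (completeBipartiteGraph (Fin n) (Fin n)) c 3 2 := by
    obtain ⟨M, hM, hM'⟩ := exists_good_s6 n (hN n (by omega))
    refine ⟨colM M, fun S hS => ?_⟩
    obtain ⟨x, y, z, hxy, hxz, hyz, rfl⟩ := Finset.card_eq_three.1 hS
    simp only [Finset.coe_insert, Finset.coe_singleton]
    rcases x with x | x <;> rcases y with y | y <;> rcases z with z | z
    · exact case_LLL hM hn4 (by simpa using hxy) (by simpa using hxz) (by simpa using hyz)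
    · exact case_LLR hM hn4 (by simpa using hxy)
    · rw [Set.pair_comm]
      exact case_LLR hM hn4 (by simpa using hxz)
    · rw [Set.insert_comm, Set.pair_comm]
      exact case_RRL hM' hn4 (by simpa using hyz)
    · rw [Set.insert_comm, Set.pair_comm]
      exact case_LLR hM hn4 (by simpa using hyz)
    · rw [Set.pair_comm]
      exact case_RRL hM' hn4 (by simpa using hxz)
    · exact case_RRL hM' hn4 (by simpa using hxy)
    · exact case_RRR hM' hn4 (by simpa using hxy) (by simpa using hxz) (by simpa using hyz)
  exact ⟨key, Nat.sInf_le key⟩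
end

section
/- Let α ≥ 1 be a real number and C > 0 a constant. For every positive integer ℓ, there exists a positive integer N = N(ℓ,C,α) such that for all integers m, n with n ≥ N and n ≤ m ≤ C·n^α: rx_{3,ℓ}(K_{m,n}) = 3 if ℓ ∈ {1,2}, and rx_{3,ℓ}(K_{m,n}) = 4 if ℓ ≥ 3. -/
open SimpleGraph

section Trees
set_option linter.unusedSectionVars false
variable {V β : Type*} [DecidableEq V]

/-- Bookkeeping predicate: `T` is a rainbow tree with vertex set `W` and edge set `E`. -/
def RT (G : SimpleGraph V) (c : Sym2 V → β) (W : Finset V) (E : Finset (Sym2 V))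
    (T : G.Subgraph) : Prop :=
  T.verts = W ∧ T.edgeSet = E ∧ T.Connected ∧ E.card + 1 = W.card ∧ Set.InjOn c (E : Set (Sym2 V))

lemma card_coe_edgeSet {G : SimpleGraph V} (T : G.Subgraph) :
    Nat.card T.coe.edgeSet = T.edgeSet.ncard := by
  rw [← T.image_coe_edgeSet_coe,
    Set.ncard_image_of_injective _ (Sym2.map.injective Subtype.val_injective)]
  rfl

lemma RT.isTree {G : SimpleGraph V} {c : Sym2 V → β} {W : Finset V} {E : Finset (Sym2 V)}
    {T : G.Subgraph} (h : RT G c W E T) : T.coe.IsTree := by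
  obtain ⟨h1, h2, h3, h4, h5⟩ := h
  have : Finite T.verts := by rw [h1]; exact Finset.finite_toSet W
  rw [isTree_iff_connected_and_card]
  refine ⟨h3.coe, ?_⟩
  rw [card_coe_edgeSet, h2, Set.ncard_coe_finset, h4, h1]
  simp

lemma RT.isRainbowSTree {G : SimpleGraph V} {c : Sym2 V → β} {W : Finset V} {E : Finset (Sym2 V)}
    {T : G.Subgraph} (h : RT G c W E T) {S : Set V} (hS : S ⊆ W) : IsRainbowSTree G c S T := by
  refine ⟨by rw [h.1]; exact hS, h.isTree, by rw [h.2.1]; exact h.2.2.2.2⟩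

lemma RT.single (G : SimpleGraph V) (c : Sym2 V → β) (a : V) :
    RT G c {a} ∅ (G.singletonSubgraph a) := by
  refine ⟨by simp, by simp, Subgraph.singletonSubgraph_connected, by simp, by simp⟩

lemma RT.leaf {G : SimpleGraph V} {c : Sym2 V → β} {W : Finset V} {E : Finset (Sym2 V)}
    (h : ∃ T, RT G c W E T) (a b : V) (ha : a ∈ W) (hb : b ∉ W) (hab : G.Adj a b)
    (hc : ∀ e ∈ E, c e ≠ c s(a, b)) :
    ∃ T, RT G c (insert b W) (insert s(a, b) E) T := by
  obtain ⟨T, h1, h2, h3, h4, h5⟩ := h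
  have hE : s(a, b) ∉ E := fun hh => hc _ hh rfl
  refine ⟨T ⊔ G.subgraphOfAdj hab, ?_, ?_, ?_, ?_, ?_⟩
  · ext x
    simp only [Subgraph.verts_sup, h1, subgraphOfAdj_verts, Finset.coe_insert, Set.mem_union,
      Set.mem_insert_iff, Finset.mem_coe, Set.mem_singleton_iff]
    constructor
    · rintro (h | rfl | rfl) <;> simp_all
    · rintro (rfl | h) <;> simp_all
  · rw [Subgraph.edgeSet_sup, h2, edgeSet_subgraphOfAdj, Finset.coe_insert, Set.insert_eq,
      Set.union_comm]
  · apply Subgraph.connected_sup h3.preconnected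
      (Subgraph.subgraphOfAdj_connected hab).preconnected
    exact ⟨a, by simp [h1, ha]⟩
  · rw [Finset.card_insert_of_notMem hE, Finset.card_insert_of_notMem hb, h4]
  · rw [Finset.coe_insert, Set.injOn_insert (by simpa using hE)]
    refine ⟨h5, ?_⟩
    rintro ⟨e, he, hee⟩
    exact hc e he hee

/-- star with three leaves -/
lemma star_tree {G : SimpleGraph V} {c : Sym2 V → β} {w x y z : V}
    (hx : G.Adj w x) (hy : G.Adj w y) (hz : G.Adj w z) (hxy : x ≠ y) (hxz : x ≠ z) (hyz : y ≠ z)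
    (cxy : c s(w, x) ≠ c s(w, y)) (cxz : c s(w, x) ≠ c s(w, z)) (cyz : c s(w, y) ≠ c s(w, z)) :
    ∃ T, RT G c {z, y, x, w} {s(w, z), s(w, y), s(w, x)} T := by
  have h := RT.leaf ⟨_, RT.single G c w⟩ w x (by simp) (by simp [hx.ne']) hx (by simp)
  have h := RT.leaf h w y (by simp) (by simp [hy.ne', hxy.symm]) hy (by simpa using cxy)
  exact RT.leaf h w z (by simp) (by simp [hz.ne', hxz.symm, hyz.symm]) hz (by simp [cxz, cyz])

/-- path on four vertices -/
lemma path_tree {G : SimpleGraph V} {c : Sym2 V → β} {x w y v : V}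
    (h1 : G.Adj x w) (h2 : G.Adj w y) (h3 : G.Adj y v) (hxy : x ≠ y) (hxv : x ≠ v) (hwv : w ≠ v)
    (c1 : c s(x, w) ≠ c s(w, y)) (c2 : c s(x, w) ≠ c s(y, v)) (c3 : c s(w, y) ≠ c s(y, v)) :
    ∃ T, RT G c {v, y, w, x} {s(y, v), s(w, y), s(x, w)} T := by
  have h := RT.leaf ⟨_, RT.single G c x⟩ x w (by simp) (by simp [h1.ne']) h1 (by simp)
  have h := RT.leaf h w y (by simp) (by simp [h2.ne', hxy.symm]) h2 (by simpa using c1)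
  exact RT.leaf h y v (by simp) (by simp [h3.ne', hxv.symm, hwv.symm]) h3 (by simp [c2, c3])

/-- the spider `v - x - w - {y, z}` -/
lemma spider_tree {G : SimpleGraph V} {c : Sym2 V → β} {v x w y z : V}
    (h1 : G.Adj w y) (h2 : G.Adj w z) (h3 : G.Adj w x) (h4 : G.Adj x v)
    (hyz : y ≠ z) (hyx : y ≠ x) (hzx : z ≠ x) (hwv : w ≠ v) (hyv : y ≠ v) (hzv : z ≠ v)
    (c12 : c s(w, y) ≠ c s(w, z)) (c13 : c s(w, y) ≠ c s(w, x)) (c23 : c s(w, z) ≠ c s(w, x))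
    (c14 : c s(w, y) ≠ c s(x, v)) (c24 : c s(w, z) ≠ c s(x, v)) (c34 : c s(w, x) ≠ c s(x, v)) :
    ∃ T, RT G c {v, x, z, y, w} {s(x, v), s(w, x), s(w, z), s(w, y)} T := by
  have h := star_tree h1 h2 h3 hyz hyx hzx c12 c13 c23
  exact RT.leaf h x v (by simp) (by simp [h4.ne', hzv.symm, hyv.symm, hwv.symm]) h4
    (by simp [c14, c24, c34])

/-- A usable extra set for `S`: some rainbow tree on `S ∪ E` has all its edges touching `E`. -/
def ExtraOK (G : SimpleGraph V) (c : Sym2 V → β) (S : Finset V) (E : Finset V) : Prop :=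
  Disjoint E S ∧ ∃ T : G.Subgraph, T.verts = (S ∪ E : Finset V) ∧
    IsRainbowSTree G c (S : Set V) T ∧ ∀ e ∈ T.edgeSet, ∃ x ∈ e, x ∈ E

lemma greedy {P : Finset V → Prop} (ℓ : ℕ) :
    (∀ F : Finset V, F.card ≤ 2 * ℓ → ∃ E, P E ∧ E.card ≤ 2 ∧ Disjoint E F) →
    ∃ (E : Fin ℓ → Finset V), (∀ i, P (E i) ∧ (E i).card ≤ 2) ∧
      ∀ i j, i ≠ j → Disjoint (E i) (E j) := by
  induction ℓ with
  | zero => exact fun _ => ⟨fun i => i.elim0, fun i => i.elim0, fun i => i.elim0⟩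
  | succ k ih =>
    intro h
    obtain ⟨E, hE, hd⟩ := ih (fun F hF => h F (by omega))
    obtain ⟨A, hA, hA2, hAd⟩ := h (Finset.univ.biUnion E) (by
      refine (Finset.card_biUnion_le_card_mul _ _ 2 (fun i _ => (hE i).2)).trans ?_
      simp; omega)
    have hAd' : ∀ i, Disjoint A (E i) := fun i =>
      hAd.mono_right (Finset.subset_biUnion_of_mem E (Finset.mem_univ i))
    refine ⟨Fin.cons A E, ?_, ?_⟩
    · intro i; refine Fin.cases ?_ (fun i => ?_) i
      · exact ⟨hA, hA2⟩
      · exact hE i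
    · intro i j
      refine Fin.cases ?_ (fun i => ?_) i <;> refine Fin.cases ?_ (fun j => ?_) j
      · simp
      · intro _; simpa using hAd' j
      · intro _; simpa using (hAd' i).symm
      · intro hij; simpa using hd i j (by simpa using hij)

lemma family_of_ext {G : SimpleGraph V} {c : Sym2 V → β} {S : Finset V} {ℓ : ℕ}
    (h : ∀ F : Finset V, F.card ≤ 2 * ℓ → ∃ E, ExtraOK G c S E ∧ E.card ≤ 2 ∧ Disjoint E F) :
    ∃ T : Fin ℓ → G.Subgraph,
      (∀ i, IsRainbowSTree G c (S : Set V) (T i)) ∧ InternallyDisjoint (S : Set V) T := by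
  obtain ⟨E, hE, hd⟩ := greedy ℓ h
  choose hdS T hT1 hT2 hT3 using fun i => (hE i).1
  refine ⟨T, hT2, fun i j hij => ?_⟩
  have hv : (T i).verts ∩ (T j).verts = S := by
    rw [hT1, hT1, ← Finset.coe_inter, ← Finset.union_inter_distrib_left,
      Finset.disjoint_iff_inter_eq_empty.1 (hd i j hij), Finset.union_empty]
  refine ⟨?_, hv⟩
  rw [Set.eq_empty_iff_forall_notMem]
  rintro e ⟨he1, he2⟩
  obtain ⟨x, hx, hxE⟩ := hT3 i e he1
  have hxi := (T i).mem_verts_of_mem_edge he1 hx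
  have hxj := (T j).mem_verts_of_mem_edge he2 hx
  have : x ∈ (S : Set V) := hv ▸ ⟨hxi, hxj⟩
  exact Finset.disjoint_left.1 (hdS i) hxE this

/-- Universality of the colors between `L` and `R`, robust against forbidden vertices. -/
def ColUniv (c : Sym2 V → β) (L R : Set V) (M : ℕ) : Prop :=
  ∀ u₁ ∈ L, ∀ u₂ ∈ L, ∀ u₃ ∈ L, u₁ ≠ u₂ → u₁ ≠ u₃ → u₂ ≠ u₃ → ∀ c₁ c₂ c₃ : β,
    ∀ F : Finset V, F.card ≤ M → ∃ w ∈ R, w ∉ F ∧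
      c s(w, u₁) = c₁ ∧ c s(w, u₂) = c₂ ∧ c s(w, u₃) = c₃

lemma ColUniv.two {c : Sym2 V → β} {L R : Set V} {M : ℕ} (h : ColUniv c L R M)
    (hL : ∀ a b, ∃ z ∈ L, z ≠ a ∧ z ≠ b) {u₁ u₂ : V} (h₁ : u₁ ∈ L) (h₂ : u₂ ∈ L) (h12 : u₁ ≠ u₂)
    (c₁ c₂ : β) (F : Finset V) (hF : F.card ≤ M) :
    ∃ w ∈ R, w ∉ F ∧ c s(w, u₁) = c₁ ∧ c s(w, u₂) = c₂ := by
  obtain ⟨z, hz, hz1, hz2⟩ := hL u₁ u₂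
  obtain ⟨w, hw, hwF, hh⟩ := h u₁ h₁ u₂ h₂ z hz h12 hz1.symm hz2.symm c₁ c₂ c₁ F hF
  exact ⟨w, hw, hwF, hh.1, hh.2.1⟩

lemma mono_side {G : SimpleGraph V} {c : Sym2 V → β} {L R : Set V} {ℓ : ℕ}
    (hU : ColUniv c L R (2 * ℓ + 5)) (hadj : ∀ a ∈ L, ∀ b ∈ R, G.Adj b a)
    {k1 k2 k3 : β} (h12 : k1 ≠ k2) (h13 : k1 ≠ k3) (h23 : k2 ≠ k3)
    {x y z : V} (hx : x ∈ L) (hy : y ∈ L) (hz : z ∈ L) (hxy : x ≠ y) (hxz : x ≠ z) (hyz : y ≠ z) :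
    ∃ T : Fin ℓ → G.Subgraph,
      (∀ i, IsRainbowSTree G c (({x, y, z} : Finset V) : Set V) (T i)) ∧
      InternallyDisjoint (({x, y, z} : Finset V) : Set V) T := by
  apply family_of_ext
  intro F hF
  obtain ⟨w, hw, hwF, e1, e2, e3⟩ := hU x hx y hy z hz hxy hxz hyz k1 k2 k3 F (by omega)
  obtain ⟨T, hT⟩ := star_tree (c := c) (hadj x hx w hw) (hadj y hy w hw) (hadj z hz w hw) hxy hxz hyz
    (by rw [e1, e2]; exact h12) (by rw [e1, e3]; exact h13) (by rw [e2, e3]; exact h23)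
  refine ⟨{w}, ⟨?_, T, ?_, hT.isRainbowSTree ?_, ?_⟩, by simp, by simpa using hwF⟩
  · have := (hadj x hx w hw).ne; have := (hadj y hy w hw).ne; have := (hadj z hz w hw).ne
    simp [*]
  · rw [hT.1]; ext t; simp; tauto
  · intro t; simp; tauto
  · rw [hT.2.1]
    intro e he
    simp at he
    refine ⟨w, ?_, by simp⟩
    rcases he with rfl | rfl | rfl <;> simp

lemma mixed_four {G : SimpleGraph V} {c : Sym2 V → Fin 4} {L R : Set V} {ℓ : ℕ}
    (hU : ColUniv c L R (2 * ℓ + 5)) (hU' : ColUniv c R L (2 * ℓ + 5))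
    (hadj : ∀ a ∈ L, ∀ b ∈ R, G.Adj b a)
    (hL : ∀ a b, ∃ z ∈ L, z ≠ a ∧ z ≠ b) (hR : ∀ a b, ∃ z ∈ R, z ≠ a ∧ z ≠ b)
    {x y z : V} (hx : x ∈ L) (hy : y ∈ L) (hz : z ∈ R) (hxy : x ≠ y) :
    ∃ T : Fin ℓ → G.Subgraph,
      (∀ i, IsRainbowSTree G c (({x, y, z} : Finset V) : Set V) (T i)) ∧
      InternallyDisjoint (({x, y, z} : Finset V) : Set V) T := by
  apply family_of_ext
  intro F hF
  obtain ⟨w, hw, hwF, e1, e2⟩ := hU.two hL hx hy hxy 0 1 (insert z F)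
    ((Finset.card_insert_le _ _).trans (by omega))
  have hwz : w ≠ z := fun h => hwF (by simp [h])
  obtain ⟨t, ht, htF, e3, e4⟩ := hU'.two hR hw hz hwz 2 3 (insert x (insert y F))
    ((Finset.card_insert_le _ _).trans
      ((Nat.succ_le_succ (Finset.card_insert_le _ _)).trans (by omega)))
  simp only [Finset.mem_insert, not_or] at hwF htF
  rw [Sym2.eq_swap] at e3
  have n1 := (hadj x hx z hz).ne
  have n2 := (hadj y hy z hz).ne
  have n3 := (hadj x hx w hw).ne
  have n4 := (hadj y hy w hw).ne
  have n5 := (hadj t ht z hz).ne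
  obtain ⟨T, hT⟩ := spider_tree (c := c) (hadj x hx w hw) (hadj y hy w hw) (hadj t ht w hw)
    (hadj t ht z hz).symm hxy (Ne.symm htF.1) (Ne.symm htF.2.1) hwz n1.symm n2.symm
    (by rw [e1, e2]; decide) (by rw [e1, e3]; decide) (by rw [e2, e3]; decide)
    (by rw [e1, e4]; decide) (by rw [e2, e4]; decide) (by rw [e3, e4]; decide)
  refine ⟨{w, t}, ⟨?_, T, ?_, hT.isRainbowSTree ?_, ?_⟩, Finset.card_le_two, ?_⟩
  · simp [n3.symm, n4.symm, n5, hwz.symm, Ne.symm htF.1, Ne.symm htF.2.1]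
  · rw [hT.1]; ext t; simp; tauto
  · intro t; simp; tauto
  · rw [hT.2.1]
    intro e he
    simp at he
    rcases he with rfl | rfl | rfl | rfl
    · exact ⟨t, by simp⟩
    all_goals exact ⟨w, by simp⟩
  · simp [*]

lemma fin3_aux : ∀ k : Fin 3, ∃ a b : Fin 3, a ≠ b ∧ a ≠ k ∧ b ≠ k := by decide

lemma mixed_three {G : SimpleGraph V} {c : Sym2 V → Fin 3} {L R : Set V}
    (hU : ColUniv c L R 9)
    (hadj : ∀ a ∈ L, ∀ b ∈ R, G.Adj b a)
    (hL : ∀ a b, ∃ z ∈ L, z ≠ a ∧ z ≠ b)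
    {x y z : V} (hx : x ∈ L) (hy : y ∈ L) (hz : z ∈ R) (hxy : x ≠ y) :
    ∃ T : Fin 2 → G.Subgraph,
      (∀ i, IsRainbowSTree G c (({x, y, z} : Finset V) : Set V) (T i)) ∧
      InternallyDisjoint (({x, y, z} : Finset V) : Set V) T := by
  obtain ⟨a, b, hab, ha, hb⟩ := fin3_aux (c s(y, z))
  obtain ⟨a', b', hab', ha', hb'⟩ := fin3_aux (c s(x, z))
  obtain ⟨w, hw, hwF, e1, e2⟩ := hU.two hL hx hy hxy a b {z} (by simp)
  obtain ⟨w', hw', hwF', e1', e2'⟩ := hU.two hL hy hx hxy.symm a' b' {z, w}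
    (Finset.card_le_two.trans (by omega))
  simp only [Finset.mem_insert, Finset.mem_singleton, not_or] at hwF hwF'
  have n1 := (hadj x hx z hz).ne
  have n2 := (hadj y hy z hz).ne
  have n3 := (hadj x hx w hw).ne
  have n4 := (hadj y hy w hw).ne
  have n5 := (hadj x hx w' hw').ne
  have n6 := (hadj y hy w' hw').ne
  obtain ⟨T, hT⟩ := path_tree (c := c) (hadj x hx w hw).symm (hadj y hy w hw) (hadj y hy z hz).symm
    hxy n1.symm hwF (by rw [Sym2.eq_swap, e1, e2]; exact hab) (by rw [Sym2.eq_swap, e1]; exact ha)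
    (by rw [e2]; exact hb)
  obtain ⟨T', hT'⟩ := path_tree (c := c) (hadj y hy w' hw').symm (hadj x hx w' hw')
    (hadj x hx z hz).symm
    hxy.symm n2.symm hwF'.1 (by rw [Sym2.eq_swap, e1', e2']; exact hab')
    (by rw [Sym2.eq_swap, e1']; exact ha') (by rw [e2']; exact hb')
  have key : T.edgeSet ∩ T'.edgeSet = ∅ ∧
      T.verts ∩ T'.verts = (({x, y, z} : Finset V) : Set V) := by
    constructor
    · rw [hT.2.1, hT'.2.1, Set.eq_empty_iff_forall_notMem]
      rintro e ⟨he, he'⟩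
      simp at he he'
      rcases he with rfl | rfl | rfl <;> simp at he' <;> grind
    · rw [hT.1, hT'.1]
      ext t
      simp
      grind
  refine ⟨![T, T'], ?_, ?_⟩
  · intro i
    fin_cases i
    · exact hT.isRainbowSTree (by intro t; simp; tauto)
    · exact hT'.isRainbowSTree (by intro t; simp; tauto)
  · intro i j hij
    fin_cases i <;> fin_cases j
    · simp at hij
    · exact key
    · simpa [Set.inter_comm] using key
    · simp at hij

/-- Putting the cases together. -/
lemma assemble {G : SimpleGraph V} {c : Sym2 V → β} {L R : Set V} {ℓ : ℕ}
    (hLR : ∀ v, v ∈ L ∨ v ∈ R)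
    (P : Finset V → Prop)
    (hP : P = fun S : Finset V => ∃ T : Fin ℓ → G.Subgraph,
      (∀ i, IsRainbowSTree G c (S : Set V) (T i)) ∧ InternallyDisjoint (S : Set V) T)
    (h1 : ∀ x ∈ L, ∀ y ∈ L, ∀ z ∈ L, x ≠ y → x ≠ z → y ≠ z → P {x, y, z})
    (h2 : ∀ x ∈ R, ∀ y ∈ R, ∀ z ∈ R, x ≠ y → x ≠ z → y ≠ z → P {x, y, z})
    (h3 : ∀ x ∈ L, ∀ y ∈ L, ∀ z ∈ R, x ≠ y → P {x, y, z})
    (h4 : ∀ x ∈ R, ∀ y ∈ R, ∀ z ∈ L, x ≠ y → P {x, y, z}) :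
    HasRainbowSTrees G c 3 ℓ := by
  intro S hS
  obtain ⟨x, y, z, hxy, hxz, hyz, rfl⟩ := Finset.card_eq_three.1 hS
  suffices P {x, y, z} by rw [hP] at this; exact this
  have p1 : ({x, y, z} : Finset V) = {x, z, y} := by ext; simp; tauto
  have p2 : ({x, y, z} : Finset V) = {y, z, x} := by ext; simp; tauto
  rcases hLR x with hx | hx <;> rcases hLR y with hy | hy <;> rcases hLR z with hz | hz
  · exact h1 x hx y hy z hz hxy hxz hyz
  · exact h3 x hx y hy z hz hxy
  · rw [p1]; exact h3 x hx z hz y hy hxz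
  · rw [p2]; exact h4 y hy z hz x hx hyz
  · rw [p2]; exact h3 y hy z hz x hx hyz
  · rw [p1]; exact h4 x hx z hz y hy hxz
  · exact h4 x hx y hy z hz hxy
  · exact h2 x hx y hy z hz hxy hxz hyz

lemma hasTrees_four {G : SimpleGraph V} {c : Sym2 V → Fin 4} {L R : Set V} {ℓ : ℕ}
    (hLR : ∀ v, v ∈ L ∨ v ∈ R)
    (hU : ColUniv c L R (2 * ℓ + 5)) (hU' : ColUniv c R L (2 * ℓ + 5))
    (hadj : ∀ a ∈ L, ∀ b ∈ R, G.Adj b a)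
    (hL : ∀ a b, ∃ z ∈ L, z ≠ a ∧ z ≠ b) (hR : ∀ a b, ∃ z ∈ R, z ≠ a ∧ z ≠ b) :
    HasRainbowSTrees G c 3 ℓ := by
  have hadj' : ∀ a ∈ R, ∀ b ∈ L, G.Adj b a := fun a ha b hb => (hadj b hb a ha).symm
  have d1 : (0 : Fin 4) ≠ 1 := by decide
  have d2 : (0 : Fin 4) ≠ 2 := by decide
  have d3 : (1 : Fin 4) ≠ 2 := by decide
  refine assemble hLR _ rfl ?_ ?_ ?_ ?_
  · exact fun x hx y hy z hz a b d => mono_side hU hadj d1 d2 d3 hx hy hz a b d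
  · exact fun x hx y hy z hz a b d => mono_side hU' hadj' d1 d2 d3 hx hy hz a b d
  · exact fun x hx y hy z hz a => mixed_four hU hU' hadj hL hR hx hy hz a
  · exact fun x hx y hy z hz a => mixed_four hU' hU hadj' hR hL hx hy hz a

lemma hasTrees_three {G : SimpleGraph V} {c : Sym2 V → Fin 3} {L R : Set V}
    (hLR : ∀ v, v ∈ L ∨ v ∈ R)
    (hU : ColUniv c L R 9) (hU' : ColUniv c R L 9)
    (hadj : ∀ a ∈ L, ∀ b ∈ R, G.Adj b a)
    (hL : ∀ a b, ∃ z ∈ L, z ≠ a ∧ z ≠ b) (hR : ∀ a b, ∃ z ∈ R, z ≠ a ∧ z ≠ b) :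
    HasRainbowSTrees G c 3 2 := by
  have hadj' : ∀ a ∈ R, ∀ b ∈ L, G.Adj b a := fun a ha b hb => (hadj b hb a ha).symm
  have d1 : (0 : Fin 3) ≠ 1 := by decide
  have d2 : (0 : Fin 3) ≠ 2 := by decide
  have d3 : (1 : Fin 3) ≠ 2 := by decide
  refine assemble hLR _ rfl ?_ ?_ ?_ ?_
  · exact fun x hx y hy z hz a b d => mono_side (ℓ := 2) hU hadj d1 d2 d3 hx hy hz a b d
  · exact fun x hx y hy z hz a b d => mono_side (ℓ := 2) hU' hadj' d1 d2 d3 hx hy hz a b d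
  · exact fun x hx y hy z hz a => mixed_three hU hadj hL hx hy hz a
  · exact fun x hx y hy z hz a => mixed_three hU' hadj' hR hx hy hz a

lemma HasRainbowSTrees.mono {G : SimpleGraph V} {c : Sym2 V → β} {k ℓ ℓ' : ℕ} (hl : ℓ ≤ ℓ')
    (h : HasRainbowSTrees G c k ℓ') : HasRainbowSTrees G c k ℓ := by
  intro S hS
  obtain ⟨T, h1, h2⟩ := h S hS
  exact ⟨fun i => T (Fin.castLE hl i), fun i => h1 _, fun i j hij => h2 _ _ (by simpa using hij)⟩

end Trees
section Lower
variable {V : Type*}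

lemma tree_card [Finite V] {G : SimpleGraph V} {t : ℕ} {c : Sym2 V → Fin t} {S : Set V}
    {T : G.Subgraph} (h : IsRainbowSTree G c S T) :
    T.edgeSet.ncard + 1 = T.verts.ncard ∧ T.verts.ncard ≤ t + 1 := by
  classical
  have h1 := (isTree_iff_connected_and_card.1 h.2.1).2
  rw [card_coe_edgeSet] at h1
  have h2 : T.verts.ncard = Nat.card T.verts := rfl
  have h3 : T.edgeSet.ncard ≤ t := by
    rw [← Set.ncard_image_of_injOn h.2.2]
    calc _ ≤ (Set.univ : Set (Fin t)).ncard := Set.ncard_le_ncard (Set.subset_univ _)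
      _ = t := by simp
  omega

lemma tree_nbr {G : SimpleGraph V} {T : G.Subgraph} (h : T.coe.IsTree) {a b : V}
    (ha : a ∈ T.verts) (hb : b ∈ T.verts) (hab : a ≠ b) : ∃ x, T.Adj a x := by
  have : Nontrivial T.verts := ⟨⟨a, ha⟩, ⟨b, hb⟩, by simpa using hab⟩
  obtain ⟨x, hx⟩ := h.connected.preconnected.exists_adj_of_nontrivial ⟨a, ha⟩
  exact ⟨x, hx⟩

lemma lower_three {m n t ℓ : ℕ} (hm : 3 ≤ m) (hℓ : 1 ≤ ℓ)
    (c : Sym2 (Fin m ⊕ Fin n) → Fin t)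
    (h : HasRainbowSTrees (completeBipartiteGraph (Fin m) (Fin n)) c 3 ℓ) : 3 ≤ t := by
  classical
  by_contra ht
  let x : Fin m ⊕ Fin n := Sum.inl ⟨0, by omega⟩
  let y : Fin m ⊕ Fin n := Sum.inl ⟨1, by omega⟩
  let z : Fin m ⊕ Fin n := Sum.inl ⟨2, by omega⟩
  have hxy : x ≠ y := by simp [x, y]
  have hc : ({x, y, z} : Finset (Fin m ⊕ Fin n)).card = 3 := by
    rw [Finset.card_eq_three]
    exact ⟨x, y, z, hxy, by simp [x, z], by simp [y, z], rfl⟩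
  obtain ⟨T, hT, -⟩ := h _ hc
  specialize hT ⟨0, hℓ⟩
  set T0 := T ⟨0, hℓ⟩
  have h1 := tree_card hT
  have hS := hT.1
  have heq : (({x, y, z} : Finset (Fin m ⊕ Fin n)) : Set _) = T0.verts := by
    apply Set.eq_of_subset_of_ncard_le hS
    rw [Set.ncard_coe_finset, hc]; omega
  obtain ⟨w, hw⟩ := tree_nbr hT.2.1 (hS (by simp : x ∈ _)) (hS (by simp : y ∈ _)) hxy
  have hwv := T0.edge_vert hw.symm
  rw [← heq] at hwv
  have := hw.adj_sub
  simp at hwv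
  rcases hwv with rfl | rfl | rfl <;> simp [x, y, z] at this

lemma lower_four {m n t ℓ : ℕ} (hm : 2 ≤ m) (hn : 1 ≤ n) (hℓ : 3 ≤ ℓ)
    (c : Sym2 (Fin m ⊕ Fin n) → Fin t)
    (h : HasRainbowSTrees (completeBipartiteGraph (Fin m) (Fin n)) c 3 ℓ) : 4 ≤ t := by
  classical
  by_contra ht
  let x : Fin m ⊕ Fin n := Sum.inl ⟨0, by omega⟩
  let y : Fin m ⊕ Fin n := Sum.inl ⟨1, by omega⟩
  let v : Fin m ⊕ Fin n := Sum.inr ⟨0, by omega⟩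
  have hxy : x ≠ y := by simp [x, y]
  have hxv : x ≠ v := by simp [x, v]
  have hyv : y ≠ v := by simp [y, v]
  have hc : ({x, y, v} : Finset (Fin m ⊕ Fin n)).card = 3 := by
    rw [Finset.card_eq_three]
    exact ⟨x, y, v, hxy, hxv, hyv, rfl⟩
  obtain ⟨T, hT, hd⟩ := h _ hc
  have key : ∀ i, s(x, v) ∈ (T i).edgeSet ∨ s(y, v) ∈ (T i).edgeSet := by
    intro i
    have hS := (hT i).1
    have h1 := tree_card (hT i)
    have hx := hS (by simp : x ∈ _)
    have hy := hS (by simp : y ∈ _)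
    have hv := hS (by simp : v ∈ _)
    obtain ⟨p, hp⟩ := tree_nbr (hT i).2.1 hv hx hxv.symm
    obtain ⟨q, hq⟩ := tree_nbr (hT i).2.1 hx hv hxv
    by_contra hcon
    rw [not_or, Subgraph.mem_edgeSet, Subgraph.mem_edgeSet] at hcon
    have hpx : p ≠ x := by rintro rfl; exact hcon.1 hp.symm
    have hpy : p ≠ y := by rintro rfl; exact hcon.2 hp.symm
    have hqv : q ≠ v := by rintro rfl; exact hcon.1 hq
    have hpG := hp.adj_sub
    have hqG := hq.adj_sub
    simp [v] at hpG
    simp [x] at hqG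
    have hpv : p ≠ v := by rintro rfl; simp [v] at hpG
    have hqx : q ≠ x := by rintro rfl; simp [x] at hqG
    have hqy : q ≠ y := by rintro rfl; simp [y] at hqG
    have hqp : q ≠ p := by rintro rfl; cases q <;> simp_all
    have hsub : (({q, p, x, y, v} : Finset (Fin m ⊕ Fin n)) : Set _) ⊆ (T i).verts := by
      intro a ha
      simp at ha
      rcases ha with rfl | rfl | rfl | rfl | rfl
      · exact (T i).edge_vert hq.symm
      · exact (T i).edge_vert hp.symm
      all_goals assumption
    have h5 := Set.ncard_le_ncard hsub
    rw [Set.ncard_coe_finset, Finset.card_insert_of_notMem (by simp [*]),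
      Finset.card_insert_of_notMem (by simp [*]), hc] at h5
    omega
  have dis : ∀ i j, i ≠ j → ∀ e, e ∈ (T i).edgeSet → e ∈ (T j).edgeSet → False := by
    intro i j hij e h1 h2
    have := (hd i j hij).1
    exact Set.eq_empty_iff_forall_notMem.1 this e ⟨h1, h2⟩
  have d01 := dis ⟨0, by omega⟩ ⟨1, by omega⟩ (by simp)
  have d02 := dis ⟨0, by omega⟩ ⟨2, by omega⟩ (by simp)
  have d12 := dis ⟨1, by omega⟩ ⟨2, by omega⟩ (by simp)
  have k0 := key ⟨0, by omega⟩
  have k1 := key ⟨1, by omega⟩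
  have k2 := key ⟨2, by omega⟩
  rcases k0 with k0 | k0 <;> rcases k1 with k1 | k1 <;> rcases k2 with k2 | k2
  all_goals first
    | exact d01 _ k0 k1
    | exact d02 _ k0 k2
    | exact d12 _ k1 k2

end Lower
section Counting

lemma card_match {ι A : Type*} [Fintype ι] [Fintype A] [DecidableEq ι] [DecidableEq A]
    (q : ℕ) (u : ι → A) (hu : Function.Injective u) (p : ι → Fin q) :
    q ^ Fintype.card A ≤
      (Finset.univ.filter fun h : A → Fin q => ∀ i, h (u i) = p i).card * q ^ Fintype.card ι := by
  classical
  have : Fintype.card (A → Fin q) ≤ Fintype.card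
      ({h : A → Fin q // ∀ i, h (u i) = p i} × (ι → Fin q)) := by
    apply Fintype.card_le_of_injective
      (fun h => (⟨Function.extend u p h, fun i => hu.extend_apply _ _ _⟩, fun i => h (u i)))
    intro h h' hh
    simp only [Prod.mk.injEq, Subtype.mk.injEq] at hh
    ext1 a
    by_cases ha : ∃ i, u i = a
    · obtain ⟨i, rfl⟩ := ha
      exact congrFun hh.2 i
    · have := congrFun hh.1 a
      rwa [Function.extend_apply' _ _ _ ha, Function.extend_apply' _ _ _ ha] at this
  simpa [Fintype.card_subtype] using this

/-- The bad colorings for one tuple and one pattern. -/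
lemma card_bad_s9 {ι A B : Type*} [Fintype ι] [Fintype A] [DecidableEq ι] [DecidableEq A]
    [Fintype B] [DecidableEq B]
    (q : ℕ) (hq : 0 < q) (u : ι → A) (hu : Function.Injective u) (p : ι → Fin q) :
    ((Finset.univ.filter fun g : B → A → Fin q => ∀ w, ¬ ∀ i, g w (u i) = p i).card : ℝ) ≤
      (1 - ((q : ℝ) ^ Fintype.card ι)⁻¹) ^ Fintype.card B *
        (q : ℝ) ^ (Fintype.card A * Fintype.card B) := by
  classical
  have h1 : (Finset.univ.filter fun g : B → A → Fin q => ∀ w, ¬ ∀ i, g w (u i) = p i) =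
      Fintype.piFinset fun _ : B =>
        (Finset.univ.filter fun h : A → Fin q => ¬ ∀ i, h (u i) = p i) := by
    ext g
    simp [Fintype.mem_piFinset]
  rw [h1, Fintype.card_piFinset, Finset.prod_const, Finset.card_univ, pow_mul, ← mul_pow]
  push_cast
  refine pow_le_pow_left₀ (by positivity) ?_ _
  have h2 := Finset.card_filter_add_card_filter_not (s := (Finset.univ : Finset (A → Fin q)))
    (fun h : A → Fin q => ∀ i, h (u i) = p i)
  have h3 := card_match q u hu p
  rw [Finset.card_univ, Fintype.card_fun, Fintype.card_fin] at h2
  have h2' : ((Finset.univ.filter fun h : A → Fin q => ∀ i, h (u i) = p i).card : ℝ) +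
      ((Finset.univ.filter fun h : A → Fin q => ¬ ∀ i, h (u i) = p i).card : ℝ) =
      (q : ℝ) ^ Fintype.card A := by exact_mod_cast h2
  have h3' : (q : ℝ) ^ Fintype.card A ≤
      ((Finset.univ.filter fun h : A → Fin q => ∀ i, h (u i) = p i).card : ℝ) *
      (q : ℝ) ^ Fintype.card ι := by exact_mod_cast h3
  have hq' : (0 : ℝ) < (q : ℝ) ^ Fintype.card ι := by positivity
  have h4 := (div_le_iff₀ hq').2 h3'
  rw [sub_mul, one_mul, inv_mul_eq_div]
  linarith

/-- `g` is universal for `ι`-tuples. -/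
def TupUniv (ι : Type*) {A B : Type*} {q : ℕ} (g : B → A → Fin q) : Prop :=
  ∀ (u : ι → A), Function.Injective u → ∀ p : ι → Fin q, ∃ w, ∀ i, g w (u i) = p i

open Classical in
lemma card_notUniv {ι A B : Type*} [Fintype ι] [Fintype A] [Fintype B]
    [DecidableEq A] [DecidableEq B]
    (q : ℕ) (hq : 0 < q) :
    ((Finset.univ.filter fun g : B → A → Fin q => ¬ TupUniv ι g).card : ℝ) ≤
      ((Fintype.card A : ℝ) ^ Fintype.card ι * (q : ℝ) ^ Fintype.card ι) *
      ((1 - ((q : ℝ) ^ Fintype.card ι)⁻¹) ^ Fintype.card B *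
        (q : ℝ) ^ (Fintype.card A * Fintype.card B)) := by
  set X := ((1 - ((q : ℝ) ^ Fintype.card ι)⁻¹) ^ Fintype.card B *
        (q : ℝ) ^ (Fintype.card A * Fintype.card B)) with hX
  have hX0 : 0 ≤ X := by
    have : ((q : ℝ) ^ Fintype.card ι)⁻¹ ≤ 1 :=
      inv_le_one_of_one_le₀ (one_le_pow₀ (by exact_mod_cast hq))
    have : 0 ≤ 1 - ((q : ℝ) ^ Fintype.card ι)⁻¹ := by linarith
    positivity
  let bad : (ι → A) × (ι → Fin q) → Finset (B → A → Fin q) := fun up =>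
    if Function.Injective up.1 then
      (Finset.univ.filter fun g : B → A → Fin q => ∀ w, ¬ ∀ i, g w (up.1 i) = up.2 i) else ∅
  have hsub : (Finset.univ.filter fun g : B → A → Fin q => ¬ TupUniv ι g) ⊆
      Finset.univ.biUnion bad := by
    intro g hg
    replace hg := (Finset.mem_filter.1 hg).2
    unfold TupUniv at hg
    push Not at hg
    obtain ⟨u, hu, p, hp⟩ := hg
    simp only [Finset.mem_biUnion, Finset.mem_univ, true_and]
    refine ⟨(u, p), ?_⟩
    simp only [bad, hu, if_true, Finset.mem_filter, Finset.mem_univ, true_and]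
    intro w hw
    obtain ⟨i, hi⟩ := hp w
    exact hi (hw i)
  have hb : ∀ up, ((bad up).card : ℝ) ≤ X := by
    intro up
    simp only [bad]
    split_ifs with h
    · exact card_bad_s9 q hq up.1 h up.2
    · simpa using hX0
  calc _ ≤ ((Finset.univ.biUnion bad).card : ℝ) := by exact_mod_cast Finset.card_le_card hsub
    _ ≤ ∑ up, ((bad up).card : ℝ) := by exact_mod_cast Finset.card_biUnion_le
    _ ≤ ∑ up : (ι → A) × (ι → Fin q), X := Finset.sum_le_sum fun up _ => hb up
    _ = _ := by simp [Fintype.card_prod]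

lemma exists_univ {ι : Type*} [Fintype ι] (q m n : ℕ) (hq : 0 < q)
    (h : (m : ℝ) ^ Fintype.card ι * (q : ℝ) ^ Fintype.card ι *
        (1 - ((q : ℝ) ^ Fintype.card ι)⁻¹) ^ n +
      (n : ℝ) ^ Fintype.card ι * (q : ℝ) ^ Fintype.card ι *
        (1 - ((q : ℝ) ^ Fintype.card ι)⁻¹) ^ m < 1) :
    ∃ f : Fin m → Fin n → Fin q, TupUniv ι f ∧ TupUniv ι (fun w u => f u w) := by
  classical
  by_contra hcon
  push Not at hcon
  have h1 := card_notUniv (ι := ι) (A := Fin n) (B := Fin m) q hq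
  have h2 := card_notUniv (ι := ι) (A := Fin m) (B := Fin n) q hq
  have hle : Fintype.card (Fin m → Fin n → Fin q) ≤
      (Finset.univ.filter fun g : Fin m → Fin n → Fin q => ¬ TupUniv ι g).card +
      (Finset.univ.filter fun g : Fin n → Fin m → Fin q => ¬ TupUniv ι g).card := by
    have e : (Finset.univ.filter fun g : Fin n → Fin m → Fin q => ¬ TupUniv ι g).card =
        (Finset.univ.filter fun f : Fin m → Fin n → Fin q =>
          ¬ TupUniv ι (fun w u => f u w)).card := by
      symm
      apply Finset.card_bij (fun f _ => fun w u => f u w)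
      · intro f hf; simpa using hf
      · intro f _ f' _ hff; ext1 a; ext1 b; exact congrFun (congrFun hff b) a
      · intro g hg; exact ⟨fun u w => g w u, by simpa using hg, rfl⟩
    rw [e, ← Finset.card_univ]
    refine le_trans (Finset.card_le_card ?_) (Finset.card_union_le _ _)
    intro f _
    simp only [Finset.mem_union, Finset.mem_filter, Finset.mem_univ, true_and]
    by_cases hf : TupUniv ι f
    · exact Or.inr (hcon f hf)
    · exact Or.inl hf
  have hle' : ((q : ℝ) ^ (m * n)) ≤
      ((Finset.univ.filter fun g : Fin m → Fin n → Fin q => ¬ TupUniv ι g).card : ℝ) +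
      ((Finset.univ.filter fun g : Fin n → Fin m → Fin q => ¬ TupUniv ι g).card : ℝ) := by
    have : Fintype.card (Fin m → Fin n → Fin q) = q ^ (m * n) := by
      simp [← pow_mul, mul_comm]
    rw [this] at hle
    exact_mod_cast hle
  simp only [Fintype.card_fin] at h1 h2
  rw [mul_comm n m] at h1
  have hpos : (0 : ℝ) < (q : ℝ) ^ (m * n) := by positivity
  have := mul_lt_mul_of_pos_right h hpos
  rw [← mul_assoc] at h1 h2
  rw [add_mul, one_mul] at this
  linarith

lemma exists_N (α : ℝ) (C : ℝ) (hC : 0 < C) (k q : ℕ) (hq : 0 < q) :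
    ∃ N : ℕ, ∀ m n : ℕ, N ≤ n → n ≤ m → (m : ℝ) ≤ C * (n : ℝ) ^ α →
      (m : ℝ) ^ k * (q : ℝ) ^ k * (1 - ((q : ℝ) ^ k)⁻¹) ^ n +
      (n : ℝ) ^ k * (q : ℝ) ^ k * (1 - ((q : ℝ) ^ k)⁻¹) ^ m < 1 := by
  set r : ℝ := 1 - ((q : ℝ) ^ k)⁻¹ with hr
  have hqk : (1 : ℝ) ≤ (q : ℝ) ^ k := one_le_pow₀ (by exact_mod_cast hq)
  have hr0 : 0 ≤ r := by
    have := inv_le_one_of_one_le₀ hqk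
    linarith
  have hr1 : r < 1 := by
    have : 0 < ((q : ℝ) ^ k)⁻¹ := by positivity
    linarith
  obtain ⟨a, ha⟩ := exists_nat_ge α
  have ht := (tendsto_pow_const_mul_const_pow_of_lt_one (a * k) hr0 hr1).const_mul
    (2 * C ^ k * (q : ℝ) ^ k)
  rw [mul_zero] at ht
  obtain ⟨N, hN⟩ := Filter.eventually_atTop.1 (ht.eventually (gt_mem_nhds one_pos))
  refine ⟨max N 1, fun m n hn hnm hm => ?_⟩
  have hn1 : (1 : ℝ) ≤ n := by exact_mod_cast (le_max_right _ _).trans hn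
  have hm' : (m : ℝ) ≤ C * (n : ℝ) ^ a := by
    refine hm.trans (mul_le_mul_of_nonneg_left ?_ hC.le)
    rw [← Real.rpow_natCast]
    exact Real.rpow_le_rpow_of_exponent_le hn1 ha
  have hmk : (m : ℝ) ^ k ≤ C ^ k * (n : ℝ) ^ (a * k) := by
    calc (m : ℝ) ^ k ≤ (C * (n : ℝ) ^ a) ^ k := pow_le_pow_left₀ (by positivity) hm' _
      _ = _ := by rw [mul_pow, ← pow_mul]
  have hnk : (n : ℝ) ^ k ≤ (m : ℝ) ^ k := pow_le_pow_left₀ (by positivity) (by exact_mod_cast hnm) _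
  have hrm : r ^ m ≤ r ^ n := pow_le_pow_of_le_one hr0 hr1.le hnm
  have hX := hN n ((le_max_left _ _).trans hn)
  have b1 : (m : ℝ) ^ k * (q : ℝ) ^ k * r ^ n ≤ C ^ k * (n : ℝ) ^ (a * k) * (q : ℝ) ^ k * r ^ n := by
    gcongr
  have b2 : (n : ℝ) ^ k * (q : ℝ) ^ k * r ^ m ≤ C ^ k * (n : ℝ) ^ (a * k) * (q : ℝ) ^ k * r ^ n := by
    gcongr
    exact hnk.trans hmk
  calc _ ≤ _ := add_le_add b1 b2
    _ = 2 * C ^ k * (q : ℝ) ^ k * ((n : ℝ) ^ (a * k) * r ^ n) := by ring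
    _ < 1 := hX

/-- From tuples to robust triples. -/
lemma TupUniv.robust {A B : Type*} [Fintype A] {q M : ℕ} (hq : 2 ≤ q)
    (hA : M + 3 ≤ Fintype.card A)
    {g : B → A → Fin q} (hg : TupUniv (Fin 3 ⊕ Fin M) g) (u : Fin 3 → A)
    (hu : Function.Injective u) (p : Fin 3 → Fin q) (F : Finset B) (hF : F.card ≤ M) :
    ∃ w, w ∉ F ∧ ∀ i, g w (u i) = p i := by
  classical
  have : Fintype.card (Fin M) ≤ Fintype.card {x // x ∉ Set.range u} := by
    rw [Fintype.card_subtype_compl (fun x => x ∈ Set.range u), Fintype.card_fin]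
    have : Fintype.card {x // x ∈ Set.range u} = 3 := by
      rw [← Nat.card_eq_fintype_card]
      exact (Nat.card_range_of_injective hu).trans (by simp)
    omega
  obtain ⟨v⟩ := Function.Embedding.nonempty_of_card_le this
  have hinj : Function.Injective (Sum.elim u (fun j => (v j : A))) := by
    apply hu.sumElim (Subtype.val_injective.comp v.injective)
    intro i j h
    exact (v j).2 ⟨i, h⟩
  choose w hw using fun s : Fin M → Fin q => hg _ hinj (Sum.elim p s)
  have hwi : Function.Injective w := by
    intro s s' h
    ext1 j
    have h1 := hw s (Sum.inr j)
    have h2 := hw s' (Sum.inr j)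
    rw [h] at h1
    simpa using h1.symm.trans h2
  have hcard : F.card < (Finset.univ.image w).card := by
    rw [Finset.card_image_of_injective _ hwi]
    simp
    calc F.card ≤ M := hF
      _ < 2 ^ M := Nat.lt_two_pow_self
      _ ≤ q ^ M := Nat.pow_le_pow_left hq M
  obtain ⟨b, hb, hbF⟩ := Finset.exists_mem_notMem_of_card_lt_card hcard
  simp only [Finset.mem_image, Finset.mem_univ, true_and] at hb
  obtain ⟨s, rfl⟩ := hb
  exact ⟨w s, hbF, fun i => by simpa using hw s (Sum.inl i)⟩

end Counting

section Final

/-- The edge-coloring attached to a matrix of colors. -/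
def colorOf {A B : Type*} {q : ℕ} [NeZero q] (f : A → B → Fin q) : Sym2 (A ⊕ B) → Fin q :=
  Sym2.lift ⟨fun x y => match x, y with
    | Sum.inl a, Sum.inr b => f a b
    | Sum.inr b, Sum.inl a => f a b
    | Sum.inl _, Sum.inl _ => 0
    | Sum.inr _, Sum.inr _ => 0, by
      rintro (a | a) (b | b) <;> rfl⟩

lemma inj_three {A : Type*} {a b c : A} (h1 : a ≠ b) (h2 : a ≠ c) (h3 : b ≠ c) :
    Function.Injective ![a, b, c] := by
  intro i j
  fin_cases i <;> fin_cases j <;> simp [h1, h2, h3, h1.symm, h2.symm, h3.symm]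

lemma exists_coloring (α : ℝ) (C : ℝ) (hC : 0 < C) (q M : ℕ) [NeZero q] (hq : 2 ≤ q) :
    ∃ N : ℕ, ∀ m n : ℕ, N ≤ n → n ≤ m → (m : ℝ) ≤ C * (n : ℝ) ^ α →
      ∃ c : Sym2 (Fin m ⊕ Fin n) → Fin q,
        ColUniv c (Set.range Sum.inl) (Set.range Sum.inr) M ∧
        ColUniv c (Set.range Sum.inr) (Set.range Sum.inl) M := by
  obtain ⟨N, hN⟩ := exists_N α C hC (Fintype.card (Fin 3 ⊕ Fin M)) q (by omega)
  refine ⟨max N (M + 3), fun m n hn hnm hm => ?_⟩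
  have hn3 : M + 3 ≤ n := (le_max_right _ _).trans hn
  obtain ⟨f, hf1, hf2⟩ := exists_univ (ι := Fin 3 ⊕ Fin M) q m n (by omega)
    (hN m n ((le_max_left _ _).trans hn) hnm hm)
  refine ⟨colorOf f, ?_, ?_⟩
  · rintro _ ⟨a, rfl⟩ _ ⟨b, rfl⟩ _ ⟨d, rfl⟩ hab had hbd c₁ c₂ c₃ F hF
    obtain ⟨w, hw, h⟩ := hf2.robust hq (by simp; omega) ![a, b, d]
      (inj_three (by simpa using hab) (by simpa using had) (by simpa using hbd)) ![c₁, c₂, c₃]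
      (F.preimage Sum.inr Sum.inr_injective.injOn)
      ((Finset.card_le_card_of_injOn Sum.inr (by intro x; simp) Sum.inr_injective.injOn).trans hF)
    exact ⟨Sum.inr w, ⟨w, rfl⟩, by simpa using hw, h 0, h 1, h 2⟩
  · rintro _ ⟨a, rfl⟩ _ ⟨b, rfl⟩ _ ⟨d, rfl⟩ hab had hbd c₁ c₂ c₃ F hF
    obtain ⟨w, hw, h⟩ := hf1.robust hq (by simp; omega) ![a, b, d]
      (inj_three (by simpa using hab) (by simpa using had) (by simpa using hbd)) ![c₁, c₂, c₃]
      (F.preimage Sum.inl Sum.inl_injective.injOn)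
      ((Finset.card_le_card_of_injOn Sum.inl (by intro x; simp) Sum.inl_injective.injOn).trans hF)
    exact ⟨Sum.inl w, ⟨w, rfl⟩, by simpa using hw, h 0, h 1, h 2⟩

lemma third_range {A W : Type*} [Fintype A] (g : A → W) (hg : Function.Injective g)
    (hA : 3 ≤ Fintype.card A) (a b : W) : ∃ z ∈ Set.range g, z ≠ a ∧ z ≠ b := by
  classical
  have : ({a, b} : Finset W).card < (Finset.univ.image g).card := by
    rw [Finset.card_image_of_injective _ hg, Finset.card_univ]
    exact lt_of_le_of_lt Finset.card_le_two (by omega)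
  obtain ⟨z, hz, hz'⟩ := Finset.exists_mem_notMem_of_card_lt_card this
  simp at hz hz'
  exact ⟨z, hz, hz'⟩

end Final

theorem rx3l_Kmn (α : ℝ) (hα : 1 ≤ α) (C : ℝ) (hC : 0 < C) (ℓ : ℕ) (hℓ : 1 ≤ ℓ) :
    ∃ N : ℕ, 0 < N ∧ ∀ m n : ℕ, N ≤ n → n ≤ m → (m : ℝ) ≤ C * (n : ℝ) ^ α →
      ((ℓ = 1 ∨ ℓ = 2) →
        rainbowIndex (completeBipartiteGraph (Fin m) (Fin n)) 3 ℓ = 3) ∧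
      (3 ≤ ℓ →
        rainbowIndex (completeBipartiteGraph (Fin m) (Fin n)) 3 ℓ = 4) := by
  obtain ⟨N₁, h₁⟩ := exists_coloring α C hC 3 9 (by omega)
  obtain ⟨N₂, h₂⟩ := exists_coloring α C hC 4 (2 * ℓ + 5) (by omega)
  refine ⟨N₁ + N₂ + 3, by omega, fun m n hn hnm hm => ?_⟩
  have hLR : ∀ v : Fin m ⊕ Fin n, v ∈ Set.range (Sum.inl : Fin m → Fin m ⊕ Fin n) ∨
      v ∈ Set.range (Sum.inr : Fin n → Fin m ⊕ Fin n) := by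
    rintro (v | v) <;> simp
  have hadj : ∀ a ∈ Set.range (Sum.inl : Fin m → Fin m ⊕ Fin n),
      ∀ b ∈ Set.range (Sum.inr : Fin n → Fin m ⊕ Fin n),
      (completeBipartiteGraph (Fin m) (Fin n)).Adj b a := by
    rintro _ ⟨a, rfl⟩ _ ⟨b, rfl⟩
    simp
  have hL := third_range (Sum.inl : Fin m → Fin m ⊕ Fin n) Sum.inl_injective (by simp; omega)
  have hR := third_range (Sum.inr : Fin n → Fin m ⊕ Fin n) Sum.inr_injective (by simp; omega)
  constructor
  · intro hl
    obtain ⟨c, hc1, hc2⟩ := h₁ m n (by omega) hnm hm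
    have hmem : 3 ∈ {t : ℕ | ∃ c : Sym2 (Fin m ⊕ Fin n) → Fin t,
        HasRainbowSTrees (completeBipartiteGraph (Fin m) (Fin n)) c 3 ℓ} :=
      ⟨c, (hasTrees_three hLR hc1 hc2 hadj hL hR).mono (by omega)⟩
    apply le_antisymm (Nat.sInf_le hmem)
    apply le_csInf ⟨_, hmem⟩
    rintro t ⟨c, hc⟩
    exact lower_three (by omega) hℓ c hc
  · intro hl
    obtain ⟨c, hc1, hc2⟩ := h₂ m n (by omega) hnm hm
    have hmem : 4 ∈ {t : ℕ | ∃ c : Sym2 (Fin m ⊕ Fin n) → Fin t,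
        HasRainbowSTrees (completeBipartiteGraph (Fin m) (Fin n)) c 3 ℓ} :=
      ⟨c, hasTrees_four hLR hc1 hc2 hadj hL hR⟩
    apply le_antisymm (Nat.sInf_le hmem)
    apply le_csInf ⟨_, hmem⟩
    rintro t ⟨c, hc⟩
    exact lower_four (by omega) (by omega) hl c hc
end

section
/- For every triple of positive integers k, ℓ, r with k ≥ r ≥ 3 and ℓ > C(r,2)·⌈k/r⌉² / ⌊k/r⌋ (where C(r,2) denotes the binomial coefficient r choose 2), there exists a positive integer N = N(k,ℓ,r) such that for every integer n ≥ N, rx_{k,ℓ}(K_{r×n}) = k + 1. -/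
open SimpleGraph

/-- The balanced set of `k` vertices. -/
lemma exists_balanced (k r n : ℕ) (hr : 0 < r) (hn : k ≤ n) :
    ∃ S : Finset (Σ _ : Fin r, Fin n), S.card = k ∧ ∀ x, x ∈ S ↔ x.2.1 * r + x.1.1 < k := by
  classical
  refine ⟨Finset.univ.filter (fun x => x.2.1 * r + x.1.1 < k), ?_, by simp⟩
  have : (Finset.range k).card = k := Finset.card_range k
  rw [← this]
  refine Finset.card_bij (fun x _ => x.2.1 * r + x.1.1) ?_ ?_ ?_
  · intro x hx
    simpa using hx
  · rintro ⟨⟨i, hi⟩, ⟨j, hj⟩⟩ _ ⟨⟨i', hi'⟩, ⟨j', hj'⟩⟩ _ h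
    simp only at h
    have h1 : i = i' := by
      have := congrArg (· % r) h
      simpa [Nat.add_mod, Nat.mod_eq_of_lt hi, Nat.mod_eq_of_lt hi'] using this
    subst h1
    have h2 : j = j' := Nat.eq_of_mul_eq_mul_right hr (by omega)
    subst h2
    rfl
  · intro y hy
    have hy : y < k := by simpa using hy
    refine ⟨⟨⟨y % r, Nat.mod_lt _ hr⟩, ⟨y / r, ?_⟩⟩, ?_, ?_⟩
    · exact lt_of_le_of_lt (Nat.div_le_self _ _) (by omega)
    · simp [Nat.div_add_mod', hy]
    · simp [Nat.div_add_mod']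

/-- With at most `k` colors a rainbow tree spanning `S` has at most one vertex outside `S`. -/
lemma verts_card_le {V : Type*} [Finite V] {G : SimpleGraph V} {t : ℕ} (c : Sym2 V → Fin t)
    (T : G.Subgraph) (hT : T.coe.IsTree) (hc : Set.InjOn c T.edgeSet) :
    T.verts.ncard ≤ t + 1 := by
  have h1 := hT.connected.card_vert_le_card_edgeSet_add_one
  have h2 : Nat.card T.coe.edgeSet = T.edgeSet.ncard := by
    rw [← Subgraph.image_coe_edgeSet_coe, Set.ncard_image_of_injective]
    · rfl
    · exact Sym2.map.injective Subtype.val_injective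
  have h3 : T.edgeSet.ncard ≤ t := by
    have := Set.ncard_le_ncard_of_injOn c (t := Set.univ) (fun _ _ => Set.mem_univ _) hc
    simpa [Set.ncard_univ] using this
  have h4 : Nat.card T.verts = T.verts.ncard := rfl
  omega

lemma lower_bound (k ℓ r n t a b : ℕ) (hr : 3 ≤ r) (hrk : r ≤ k) (hn : k ≤ n)
    (ha : a * r ≤ k) (hbk : b ≤ k) (hb : ∀ y, y * r < k → y < b)
    (hab : r.choose 2 * b ^ 2 < ℓ * a)
    (c : Sym2 (Σ _ : Fin r, Fin n) → Fin t)
    (h : HasRainbowSTrees (completeMultipartiteGraph (fun _ : Fin r => Fin n)) c k ℓ) :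
    k + 1 ≤ t := by
  classical
  by_contra hlt
  have hr0 : 0 < r := by omega
  obtain ⟨S, hSk, hS⟩ := exists_balanced k r n hr0 hn
  obtain ⟨T, hT, hdis⟩ := h S hSk
  have han : a ≤ n := by nlinarith
  -- each tree has `a` edges inside `S`
  have key : ∀ i, ∃ g : Fin a → Sym2 (Σ _ : Fin r, Fin n), Function.Injective g ∧
      ∀ y, g y ∈ (T i).edgeSet ∧ ∀ x ∈ g y, x ∈ S := by
    intro i
    obtain ⟨hST, htree, hc⟩ := hT i
    have hcard := verts_card_le c (T i) htree hc
    have hpart : ∃ p : Fin r, ∀ x ∈ (T i).verts, x ∉ S → x.1 = p := by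
      by_cases hex : ∃ z ∈ (T i).verts, z ∉ S
      · obtain ⟨z, hz, hzS⟩ := hex
        refine ⟨z.1, fun x hx hxS => ?_⟩
        by_contra hne
        have hxz : x ≠ z := fun e => hne (by rw [e])
        have hsub : ((insert x (insert z S) : Finset _) : Set (Σ _ : Fin r, Fin n)) ⊆ (T i).verts := by
          intro w hw
          simp only [Finset.coe_insert, Set.mem_insert_iff] at hw
          rcases hw with rfl | rfl | hw
          · exact hx
          · exact hz
          · exact hST hw
        have h1 := Set.ncard_le_ncard hsub (Set.toFinite _)
        rw [Set.ncard_coe_finset, Finset.card_insert_of_notMem (by simp [hxz, hxS]),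
          Finset.card_insert_of_notMem hzS] at h1
        omega
      · push Not at hex
        exact ⟨⟨0, hr0⟩, fun x hx hxS => absurd (hex x hx) hxS⟩
    obtain ⟨p, hp⟩ := hpart
    have hnt : Nontrivial (T i).verts := by
      have : 1 < S.card := by omega
      obtain ⟨x, hx, y, hy, hxy⟩ := Finset.one_lt_card.1 this
      exact ⟨⟨⟨x, hST hx⟩, ⟨y, hST hy⟩, fun e => hxy (congrArg Subtype.val e)⟩⟩
    let X : Fin a → (Σ _ : Fin r, Fin n) := fun y => ⟨p, ⟨y.1, by omega⟩⟩
    have hX : ∀ y, X y ∈ S := by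
      intro y
      rw [hS]
      have := y.2
      have := p.2
      change y.1 * r + p.1 < k
      have : (y.1 + 1) * r ≤ a * r := Nat.mul_le_mul_right _ (by omega)
      nlinarith
    have hw : ∀ y, ∃ w, (T i).Adj (X y) w := by
      intro y
      obtain ⟨w, hw⟩ := htree.connected.preconnected.exists_adj_of_nontrivial ⟨X y, hST (hX y)⟩
      exact ⟨w, hw⟩
    choose w hw using hw
    have hwp : ∀ y, (w y).1 ≠ p := by
      intro y e
      have := (T i).adj_sub (hw y)
      simp only [completeMultipartiteGraph, comap_adj, top_adj] at this
      exact this e.symm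
    refine ⟨fun y => s(X y, w y), ?_, fun y => ⟨hw y, ?_⟩⟩
    · intro y y' e
      simp only [Sym2.eq_iff] at e
      rcases e with ⟨e, _⟩ | ⟨e, _⟩
      · have := (Sigma.mk.inj_iff.1 e).2
        simp at this
        exact Fin.ext this
      · exact absurd (by rw [← e]) (hwp y')
    · intro x hx
      rcases Sym2.mem_iff.1 hx with rfl | rfl
      · exact hX y
      · by_contra hns
        exact hwp y (hp _ ((T i).edge_vert (hw y).symm) hns)
  choose g hginj hg using key
  let φ : Fin r × Fin b → (Σ _ : Fin r, Fin n) := fun x => ⟨x.1, ⟨x.2.1, by omega⟩⟩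
  let F := (completeEquipartiteGraph r b).edgeFinset.image (Sym2.map φ)
  have hF : F.card ≤ r.choose 2 * b ^ 2 := by
    rw [← card_edgeFinset_completeEquipartiteGraph]
    exact Finset.card_image_le
  have hle : (Finset.univ : Finset (Fin ℓ × Fin a)).card ≤ F.card := by
    apply Finset.card_le_card_of_injOn (fun z => g z.1 z.2)
    · intro z _
      obtain ⟨h1, h2⟩ := hg z.1 z.2
      change g z.1 z.2 ∈ F
      generalize g z.1 z.2 = e at h1 h2
      induction e with | _ x y
      have hx := h2 x (by simp)
      have hy := h2 y (by simp)
      rw [hS] at hx hy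
      have hxy := (T z.1).adj_sub h1
      simp only [completeMultipartiteGraph, comap_adj, top_adj] at hxy
      refine Finset.mem_image.2 ⟨s((x.1, ⟨x.2.1, hb _ (by omega)⟩), (y.1, ⟨y.2.1, hb _ (by omega)⟩)),
        ?_, ?_⟩
      · simpa using hxy
      · simp [φ]
    · rintro ⟨i, y⟩ _ ⟨i', y'⟩ _ e
      simp only at e
      by_cases hi : i = i'
      · subst hi
        rw [hginj i e]
      · have := (hdis i i' hi).1
        have h2 : g i y ∈ (T i).edgeSet ∩ (T i').edgeSet :=
          ⟨(hg i y).1, by rw [e]; exact (hg i' y').1⟩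
        rw [this] at h2
        exact absurd h2 (Set.notMem_empty _)
  simp at hle
  omega

lemma lower_arith (k ℓ r : ℕ) (hr : 3 ≤ r) (hrk : r ≤ k)
    (hℓ' : ((r.choose 2 : ℚ) * (⌈(k : ℚ) / (r : ℚ)⌉ : ℚ) ^ 2 /
      (⌊(k : ℚ) / (r : ℚ)⌋ : ℚ)) < (ℓ : ℚ)) :
    ∃ a b : ℕ, a * r ≤ k ∧ b ≤ k ∧ (∀ y, y * r < k → y < b) ∧ r.choose 2 * b ^ 2 < ℓ * a := by
  have hr0 : (0 : ℚ) < r := by exact_mod_cast (by omega : 0 < r)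
  have hfl : ⌊(k : ℚ) / (r : ℚ)⌋ = ((k / r : ℕ) : ℤ) := by
    rw [Rat.floor_natCast_div_natCast]; rfl
  have hce : ⌈(k : ℚ) / (r : ℚ)⌉ = ((⌈(k : ℚ) / (r : ℚ)⌉₊ : ℕ) : ℤ) := by
    rw [Int.natCast_ceil_eq_ceil (by positivity)]
  refine ⟨k / r, ⌈(k : ℚ) / (r : ℚ)⌉₊, Nat.div_mul_le_self k r, ?_, ?_, ?_⟩
  · apply Nat.ceil_le.2
    apply div_le_self (by positivity)
    exact_mod_cast (by omega : 1 ≤ r)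
  · intro y hy
    apply Nat.lt_ceil.2
    rw [lt_div_iff₀ hr0]
    exact_mod_cast hy
  · have hpos : 0 < k / r := Nat.div_pos hrk (by omega)
    rw [hfl, hce, div_lt_iff₀ (by exact_mod_cast hpos)] at hℓ'
    exact_mod_cast hℓ'

/-- The edges of the double star with centers `(z0, i)` and `(z1, i)` and leaves `S`. -/
def starEdge {r n : ℕ} (z0 z1 : Fin r) (S : Finset (Σ _ : Fin r, Fin n)) (i : Fin n) :
    Option S → Sym2 (Σ _ : Fin r, Fin n)
  | none => s(⟨z0, i⟩, ⟨z1, i⟩)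
  | some x => s(x.1, ⟨if x.1.1 = z0 then z1 else z0, i⟩)

lemma starEdge_inj {r n : ℕ} {z0 z1 : Fin r} (hz : z0 ≠ z1) {S : Finset (Σ _ : Fin r, Fin n)}
    {i j : Fin n} (hi : ∀ x ∈ S, x.2 ≠ i) (hj : ∀ x ∈ S, x.2 ≠ j) {o p : Option S}
    (h : starEdge z0 z1 S i o = starEdge z0 z1 S j p) : i = j ∧ o = p := by
  rcases o with _ | ⟨⟨x1, x2⟩, hx⟩ <;> rcases p with _ | ⟨⟨y1, y2⟩, hy⟩ <;>
    simp only [starEdge, Sym2.eq_iff, Sigma.mk.injEq, heq_eq_eq] at h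
  · refine ⟨?_, rfl⟩
    tauto
  · have h1 := hi _ hy
    have h2 := hj _ hy
    simp only [ne_eq] at h1 h2
    grind
  · have h1 := hi _ hx
    have h2 := hj _ hx
    simp only [ne_eq] at h1 h2
    grind
  · have h1 := hi _ hx
    have h2 := hj _ hx
    have h3 := hi _ hy
    have h4 := hj _ hy
    simp only [ne_eq] at h1 h2 h3 h4
    simp only [Option.some.injEq, Subtype.mk.injEq, Sigma.mk.injEq, heq_eq_eq]
    grind

lemma exists_star {r n : ℕ} {z0 z1 : Fin r} (hz : z0 ≠ z1) (S : Finset (Σ _ : Fin r, Fin n))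
    (i : Fin n) (hi : ∀ x ∈ S, x.2 ≠ i) :
    ∃ T : (completeMultipartiteGraph (fun _ : Fin r => Fin n)).Subgraph,
      T.verts = (S : Set _) ∪ {⟨z0, i⟩, ⟨z1, i⟩} ∧
      T.edgeSet = Set.range (starEdge z0 z1 S i) ∧ T.coe.IsTree := by
  classical
  let T : (completeMultipartiteGraph (fun _ : Fin r => Fin n)).Subgraph :=
    { verts := (S : Set _) ∪ {⟨z0, i⟩, ⟨z1, i⟩}
      Adj := fun x y => s(x, y) ∈ Set.range (starEdge z0 z1 S i)
      adj_sub := by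
        rintro x y ⟨o, ho⟩
        simp only [completeMultipartiteGraph, comap_adj, top_adj]
        rcases o with _ | ⟨w, hw⟩ <;> simp only [starEdge, Sym2.eq_iff] at ho
        · rcases ho with ⟨rfl, rfl⟩ | ⟨rfl, rfl⟩
          · exact hz
          · exact hz.symm
        · rcases ho with ⟨rfl, rfl⟩ | ⟨rfl, rfl⟩ <;> simp only <;> split_ifs <;> grind
      edge_vert := by
        rintro x y ⟨o, ho⟩
        rcases o with _ | ⟨w, hw⟩ <;> simp only [starEdge, Sym2.eq_iff] at ho
        · rcases ho with ⟨rfl, rfl⟩ | ⟨rfl, rfl⟩ <;> simp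
        · rcases ho with ⟨rfl, rfl⟩ | ⟨rfl, rfl⟩
          · left; exact hw
          · right; split_ifs <;> simp
      symm := by
        constructor
        intro x y h
        rwa [Sym2.eq_swap] }
  have hverts : T.verts = (S : Set _) ∪ {⟨z0, i⟩, ⟨z1, i⟩} := rfl
  have hedge : T.edgeSet = Set.range (starEdge z0 z1 S i) := by
    ext e
    induction e with | _ x y
    rfl
  refine ⟨T, hverts, hedge, ?_⟩
  have hu : (⟨z0, i⟩ : Σ _ : Fin r, Fin n) ∈ T.verts := by simp [hverts]
  have hv : (⟨z1, i⟩ : Σ _ : Fin r, Fin n) ∈ T.verts := by simp [hverts]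
  have huv : T.coe.Reachable ⟨_, hv⟩ ⟨_, hu⟩ := by
    apply Adj.reachable
    change s(_, _) ∈ Set.range _
    exact ⟨none, Sym2.eq_swap⟩
  have hreach : ∀ x : T.verts, T.coe.Reachable x ⟨_, hu⟩ := by
    rintro ⟨x, hx⟩
    have hx' := hx
    rw [hverts] at hx'
    rcases hx' with hx' | rfl | rfl
    · by_cases h0 : x.1 = z0
      · refine Reachable.trans (Adj.reachable ?_) huv
        change s(_, _) ∈ Set.range _
        exact ⟨some ⟨x, hx'⟩, by simp [starEdge, h0]⟩
      · apply Adj.reachable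
        change s(_, _) ∈ Set.range _
        exact ⟨some ⟨x, hx'⟩, by simp [starEdge, h0]⟩
    · exact Reachable.refl _
    · exact huv
  have hconn : T.coe.Connected := by
    have : Nonempty T.verts := ⟨⟨_, hu⟩⟩
    exact ⟨fun x y => (hreach x).trans (hreach y).symm⟩
  rw [isTree_iff_connected_and_card]
  refine ⟨hconn, le_antisymm ?_ hconn.card_vert_le_card_edgeSet_add_one⟩
  have h2 : Nat.card T.coe.edgeSet = T.edgeSet.ncard := by
    rw [← Subgraph.image_coe_edgeSet_coe, Set.ncard_image_of_injective]
    · rfl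
    · exact Sym2.map.injective Subtype.val_injective
  have h3 : T.edgeSet.ncard ≤ S.card + 1 := by
    rw [hedge, ← Set.image_univ]
    refine (Set.ncard_image_le).trans ?_
    simp [Set.ncard_univ]
  have h4 : Nat.card T.verts = T.verts.ncard := rfl
  have h5 : T.verts.ncard = S.card + 2 := by
    have : T.verts = ((insert ⟨z0, i⟩ (insert ⟨z1, i⟩ S) : Finset (Σ _ : Fin r, Fin n)) : Set _) := by
      rw [hverts]; ext; simp
    rw [this, Set.ncard_coe_finset, Finset.card_insert_of_notMem, Finset.card_insert_of_notMem]
    · intro h; exact hi _ h rfl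
    · intro h
      rcases Finset.mem_insert.1 h with h | h
      · exact hz (Sigma.mk.inj_iff.1 h).1
      · exact hi _ h rfl
  omega

/-- Pulling back along an injection preserves proportions of colorings. -/
lemma card_pullback {A B C : Type*} [Fintype A] [Fintype B] [Fintype C] [DecidableEq A]
    [DecidableEq B] [DecidableEq C]
    (f : A → B) (hf : Function.Injective f) (P : (A → C) → Prop) [DecidablePred P] :
    Fintype.card {c : B → C // P (c ∘ f)} * Fintype.card (A → C) =
      Fintype.card {g : A → C // P g} * Fintype.card (B → C) := by
  classical
  let e : A ⊕ ((Set.range f)ᶜ : Set B) ≃ B :=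
    (Equiv.sumCongr (Equiv.ofInjective f hf) (Equiv.refl _)).trans (Equiv.Set.sumCompl (Set.range f))
  let E : (B → C) ≃ (A → C) × (((Set.range f)ᶜ : Set B) → C) :=
    (Equiv.arrowCongr e.symm (Equiv.refl C)).trans (Equiv.sumArrowEquivProdArrow _ _ _)
  have hE : ∀ c, (E c).1 = c ∘ f := by
    intro c
    rfl
  have h1 : Fintype.card (B → C) = Fintype.card (A → C) * Fintype.card (((Set.range f)ᶜ : Set B) → C) := by
    rw [Fintype.card_congr E, Fintype.card_prod]
  have h2 : Fintype.card {c : B → C // P (c ∘ f)} =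
      Fintype.card {g : A → C // P g} * Fintype.card (((Set.range f)ᶜ : Set B) → C) := by
    rw [← Fintype.card_prod]
    apply Fintype.card_congr
    refine (E.subtypeEquiv (q := fun x => P x.1) (fun c => by rw [hE])).trans ?_
    exact 
      { toFun := fun x => (⟨x.1.1, x.2⟩, x.1.2)
        invFun := fun x => ⟨(x.1.1, x.2), x.1.2⟩
        left_inv := fun _ => rfl
        right_inv := fun _ => rfl }
  rw [h1, h2]
  ring

/-- Number of families of non-injective maps. -/
lemma card_bad_s11 {I O C : Type*} [Fintype I] [Fintype O] [Fintype C] [DecidableEq I]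
    [DecidableEq O] [DecidableEq C] (hOC : Fintype.card O = Fintype.card C) :
    Fintype.card {g : I × O → C // ∀ i, ¬ Function.Injective fun o => g (i, o)} ≤
      (Fintype.card (O → C) - 1) ^ Fintype.card I := by
  classical
  have e : {g : I × O → C // ∀ i, ¬ Function.Injective fun o => g (i, o)} ≃
      (I → {g : O → C // ¬ Function.Injective g}) :=
    { toFun := fun g i => ⟨fun o => g.1 (i, o), g.2 i⟩
      invFun := fun g => ⟨fun x => (g x.1).1 x.2, fun i => (g i).2⟩
      left_inv := fun _ => rfl
      right_inv := fun _ => rfl }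
  rw [Fintype.card_congr e, Fintype.card_fun]
  apply Nat.pow_le_pow_left
  have : Fintype.card {g : O → C // ¬ Function.Injective g} < Fintype.card (O → C) := by
    apply Fintype.card_subtype_lt (x := (Fintype.equivOfCardEq hOC : O → C))
    simpa using (Fintype.equivOfCardEq hOC).injective
  omega

/-- Fraction of bad colorings. -/
lemma card_bad' {I O B C : Type*} [Fintype I] [Fintype O] [Fintype B] [Fintype C] [DecidableEq I]
    [DecidableEq O] [DecidableEq B] [DecidableEq C] [Nonempty C]
    (hOC : Fintype.card O = Fintype.card C)
    (f : I × O → B) (hf : Function.Injective f) (q : ℕ) (hq : q = Fintype.card (O → C)) (s : ℕ)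
    (hs : s ≤ Fintype.card I) :
    (Fintype.card {c : B → C // ∀ i, ¬ Function.Injective fun o => c (f (i, o))} : ℝ) ≤
      (1 - 1 / (q : ℝ)) ^ s * Fintype.card (B → C) := by
  have h1 := card_pullback (C := C) f hf (fun g => ∀ i, ¬ Function.Injective fun o => g (i, o))
  have h2 := card_bad_s11 (I := I) (C := C) hOC
  have hq0 : 0 < q := by rw [hq]; exact Fintype.card_pos
  have h3 : Fintype.card (I × O → C) = q ^ Fintype.card I := by
    rw [hq, Fintype.card_fun, Fintype.card_fun, Fintype.card_prod, ← pow_mul, mul_comm]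
  rw [h3] at h1
  rw [← hq] at h2
  have hq1 : (1 : ℝ) ≤ q := by exact_mod_cast hq0
  have hρ0 : 0 ≤ 1 - 1 / (q : ℝ) := by
    rw [sub_nonneg, div_le_one (by linarith)]; exact hq1
  have hρ1 : 1 - 1 / (q : ℝ) ≤ 1 := by
    have : 0 ≤ 1 / (q : ℝ) := by positivity
    linarith
  refine le_trans ?_ (mul_le_mul_of_nonneg_right (pow_le_pow_of_le_one hρ0 hρ1 hs) (by positivity))
  have hqp : (0 : ℝ) < (q : ℝ) ^ Fintype.card I := by positivity
  rw [← mul_le_mul_iff_left₀ hqp]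
  have h1' : (Fintype.card {c : B → C // ∀ i, ¬ Function.Injective fun o => c (f (i, o))} : ℝ) *
      (q : ℝ) ^ Fintype.card I = (Fintype.card {g : I × O → C // ∀ i, ¬ Function.Injective fun o => g (i, o)} : ℝ) * Fintype.card (B → C) := by
    exact_mod_cast h1
  rw [h1']
  have h2' : (Fintype.card {g : I × O → C // ∀ i, ¬ Function.Injective fun o => g (i, o)} : ℝ) ≤
      ((q : ℝ) - 1) ^ Fintype.card I := by
    have : ((q - 1 : ℕ) : ℝ) = (q : ℝ) - 1 := by push_cast [Nat.cast_sub hq0]; ring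
    rw [← this]
    exact_mod_cast h2
  have h4 : (1 - 1 / (q : ℝ)) ^ Fintype.card I * Fintype.card (B → C) * (q : ℝ) ^ Fintype.card I =
      ((q : ℝ) - 1) ^ Fintype.card I * Fintype.card (B → C) := by
    have : (q : ℝ) - 1 = (1 - 1 / (q : ℝ)) * q := by field_simp
    rw [this, mul_pow]; ring
  rw [h4]
  exact mul_le_mul_of_nonneg_right h2' (by positivity)

lemma exists_coloring_s11 (k ℓ r n m q : ℕ) (z0 z1 : Fin r) (hz : z0 ≠ z1) (hm : ℓ * m ≤ n)
    (hq : q = (k + 1) ^ (k + 1))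
    (hsmall : ((r * n : ℕ) : ℝ) ^ k * ℓ * (1 - 1 / (q : ℝ)) ^ (m - k) < 1) :
    ∃ c : Sym2 (Σ _ : Fin r, Fin n) → Fin (k + 1),
      HasRainbowSTrees (completeMultipartiteGraph (fun _ : Fin r => Fin n)) c k ℓ := by
  classical
  let e : Fin ℓ × Fin m → Fin n := fun x => Fin.castLE hm (finProdFinEquiv x)
  have he : Function.Injective e := (Fin.castLE_injective hm).comp finProdFinEquiv.injective
  let Good : Finset (Σ _ : Fin r, Fin n) → Fin n → Prop := fun S i => ∀ x ∈ S, x.2 ≠ i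
  let Bad : Finset (Σ _ : Fin r, Fin n) × Fin ℓ →
      Finset (Sym2 (Σ _ : Fin r, Fin n) → Fin (k + 1)) := fun p =>
    Finset.univ.filter fun c => ∀ a : {a : Fin m // Good p.1 (e (p.2, a))},
      ¬ Function.Injective fun o => c (starEdge z0 z1 p.1 (e (p.2, a.1)) o)
  have hBad : ∀ p : Finset (Σ _ : Fin r, Fin n) × Fin ℓ, p.1.card = k → ((Bad p).card : ℝ) ≤
      (1 - 1 / (q : ℝ)) ^ (m - k) *
        Fintype.card (Sym2 (Σ _ : Fin r, Fin n) → Fin (k + 1)) := by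
    rintro ⟨S, j⟩ hS
    simp only at hS
    have hI : m - k ≤ Fintype.card {a : Fin m // Good S (e (j, a))} := by
      have h1 : Fintype.card {a : Fin m // ¬ Good S (e (j, a))} ≤ k := by
        rw [Fintype.card_subtype, ← hS]
        refine le_trans ?_ (Finset.card_image_le (s := S) (f := fun x => x.2))
        apply Finset.card_le_card_of_injOn (fun a => e (j, a))
        · intro a ha
          simp only [Good, ne_eq, Finset.coe_filter, Finset.mem_univ, true_and,
            Set.mem_setOf_eq] at ha
          push Not at ha
          obtain ⟨x, hx, hxa⟩ := ha
          exact Finset.mem_coe.2 (Finset.mem_image.2 ⟨x, hx, hxa⟩)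
        · intro a _ b _ h
          exact (Prod.mk.inj (he h)).2
      have h2 := Fintype.card_subtype_compl (fun a : Fin m => Good S (e (j, a)))
      rw [Fintype.card_fin] at h2
      omega
    have h := card_bad' (I := {a : Fin m // Good S (e (j, a))}) (O := Option S)
      (B := Sym2 (Σ _ : Fin r, Fin n)) (C := Fin (k + 1)) (by simp [hS])
      (fun x => starEdge z0 z1 S (e (j, x.1.1)) x.2) (by
        rintro ⟨⟨a, ha⟩, o⟩ ⟨⟨b, hb⟩, p⟩ h
        obtain ⟨h1, h2⟩ := starEdge_inj hz ha hb h
        have h3 := (Prod.mk.inj (he h1)).2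
        subst h3
        subst h2
        rfl) q (by simp [hS, hq]) (m - k) hI
    rw [Fintype.card_subtype] at h
    exact h
  let P : Finset (Finset (Σ _ : Fin r, Fin n) × Fin ℓ) :=
    (Finset.powersetCard k Finset.univ) ×ˢ Finset.univ
  have hP : (P.card : ℝ) ≤ ((r * n : ℕ) : ℝ) ^ k * ℓ := by
    have : P.card ≤ (r * n) ^ k * ℓ := by
      simp only [P, Finset.card_product, Finset.card_powersetCard, Finset.card_univ,
        Fintype.card_sigma, Fintype.card_fin, Finset.sum_const, smul_eq_mul]
      exact Nat.mul_le_mul_right _ (Nat.choose_le_pow _ _)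
    exact_mod_cast this
  have hq1 : (1 : ℝ) ≤ q := by
    have : 1 ≤ q := by rw [hq]; exact Nat.one_le_pow _ _ (by omega)
    exact_mod_cast this
  have hρ0 : 0 ≤ 1 - 1 / (q : ℝ) := by
    rw [sub_nonneg, div_le_one (by linarith)]; exact hq1
  have hlt : (P.biUnion Bad).card < (Finset.univ : Finset (Sym2 (Σ _ : Fin r, Fin n) → Fin (k + 1))).card := by
    have h1 : ((P.biUnion Bad).card : ℝ) ≤ ∑ p ∈ P, ((Bad p).card : ℝ) := by
      exact_mod_cast Finset.card_biUnion_le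
    have h2 : ∑ p ∈ P, ((Bad p).card : ℝ) ≤ P.card • ((1 - 1 / (q : ℝ)) ^ (m - k) *
        Fintype.card (Sym2 (Σ _ : Fin r, Fin n) → Fin (k + 1))) := by
      apply Finset.sum_le_card_nsmul
      intro p hp
      apply hBad
      exact (Finset.mem_powersetCard.1 (Finset.mem_product.1 hp).1).2
    have hpos : (0 : ℝ) < Fintype.card (Sym2 (Σ _ : Fin r, Fin n) → Fin (k + 1)) := by
      exact_mod_cast Fintype.card_pos
    rw [nsmul_eq_mul, ← mul_assoc] at h2
    have h3 : (P.card : ℝ) * (1 - 1 / (q : ℝ)) ^ (m - k) < 1 :=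
      lt_of_le_of_lt (mul_le_mul_of_nonneg_right hP (by positivity)) hsmall
    have h4 := mul_lt_mul_of_pos_right h3 hpos
    have : ((P.biUnion Bad).card : ℝ) < Fintype.card (Sym2 (Σ _ : Fin r, Fin n) → Fin (k + 1)) := by
      linarith
    rw [Finset.card_univ]
    exact_mod_cast this
  obtain ⟨c, -, hc⟩ := Finset.exists_mem_notMem_of_card_lt_card hlt
  refine ⟨c, fun S hS => ?_⟩
  have hgood : ∀ j : Fin ℓ, ∃ a : Fin m, Good S (e (j, a)) ∧
      Function.Injective fun o => c (starEdge z0 z1 S (e (j, a)) o) := by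
    intro j
    by_contra hno
    push Not at hno
    apply hc
    refine Finset.mem_biUnion.2 ⟨(S, j), ?_, ?_⟩
    · exact Finset.mem_product.2 ⟨Finset.mem_powersetCard.2 ⟨Finset.subset_univ _, hS⟩,
        Finset.mem_univ _⟩
    · exact Finset.mem_filter.2 ⟨Finset.mem_univ _, fun a => hno a.1 a.2⟩
  choose a hgood hinj using hgood
  choose T hTv hTe hTt using fun j => exists_star hz S (e (j, a j)) (hgood j)
  refine ⟨T, fun j => ⟨?_, hTt j, ?_⟩, fun i j hij => ⟨?_, ?_⟩⟩
  · rw [hTv]; exact Set.subset_union_left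
  · rw [hTe]
    rintro _ ⟨o, rfl⟩ _ ⟨p, rfl⟩ h
    rw [hinj j h]
  · rw [hTe, hTe, Set.eq_empty_iff_forall_notMem]
    rintro x ⟨⟨o, ho⟩, ⟨p, hp⟩⟩
    have := (starEdge_inj hz (hgood i) (hgood j) (ho.trans hp.symm)).1
    exact hij (Prod.mk.inj (he this)).1
  · have hne : e (i, a i) ≠ e (j, a j) := fun h => hij (Prod.mk.inj (he h)).1
    rw [hTv, hTv]
    ext x
    have h1 := hgood i
    have h2 := hgood j
    constructor
    · rintro ⟨hx | hx | hx, hy | hy | hy⟩ <;> try assumption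
      all_goals
        exact absurd (congrArg (fun z : (Σ _ : Fin r, Fin n) => z.2) (hx.symm.trans hy)) hne
    · intro hx
      exact ⟨Or.inl hx, Or.inl hx⟩

open Filter Topology in
lemma exists_threshold (k ℓ r : ℕ) (hℓ : 1 ≤ ℓ) (ρ : ℝ) (h0 : 0 < ρ) (h1 : ρ < 1) :
    ∃ N : ℕ, ∀ n, N ≤ n → ((r * n : ℕ) : ℝ) ^ k * ℓ * ρ ^ (n / ℓ - k) < 1 := by
  have ht := tendsto_pow_const_mul_const_pow_of_abs_lt_one k (r := ρ)
    (by rw [abs_of_pos h0]; exact h1)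
  let D : ℝ := ((r : ℝ) * ℓ * 2) ^ k * ℓ / ρ ^ k
  have ht2 := ht.const_mul D
  rw [mul_zero] at ht2
  obtain ⟨M, hM⟩ := eventually_atTop.1 (ht2.eventually (gt_mem_nhds (zero_lt_one)))
  refine ⟨ℓ * (M + k + 1), fun n hn => ?_⟩
  have hm : M + k + 1 ≤ n / ℓ := (Nat.le_div_iff_mul_le (by omega)).2 (by rw [mul_comm]; exact hn)
  set m := n / ℓ with hmdef
  have hlt := hM m (by omega)
  have hnm : n ≤ ℓ * 2 * m := by
    have := Nat.lt_mul_div_succ n (show 0 < ℓ by omega)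
    rw [← hmdef] at this
    nlinarith
  refine lt_of_le_of_lt ?_ hlt
  have hpow : ρ ^ (m - k) = ρ ^ m / ρ ^ k := by
    rw [eq_div_iff (by positivity), ← pow_add]
    congr 1; omega
  rw [hpow]
  have hnm' : ((r * n : ℕ) : ℝ) ≤ (r : ℝ) * ℓ * 2 * m := by
    have : r * n ≤ r * ℓ * 2 * m := by
      calc r * n ≤ r * (ℓ * 2 * m) := Nat.mul_le_mul_left _ hnm
        _ = _ := by ring
    exact_mod_cast this
  calc ((r * n : ℕ) : ℝ) ^ k * ℓ * (ρ ^ m / ρ ^ k)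
      ≤ ((r : ℝ) * ℓ * 2 * m) ^ k * ℓ * (ρ ^ m / ρ ^ k) := by gcongr
    _ = D * ((m : ℝ) ^ k * ρ ^ m) := by
      simp only [D]; rw [mul_pow _ (m : ℝ)]; ring

theorem rx_multipartite_eq_succ (k ℓ r : ℕ) (hr : 3 ≤ r) (hrk : r ≤ k) (hℓ : 1 ≤ ℓ)
    (hℓ' : ((r.choose 2 : ℚ) * (⌈(k : ℚ) / (r : ℚ)⌉ : ℚ) ^ 2 /
      (⌊(k : ℚ) / (r : ℚ)⌋ : ℚ)) < (ℓ : ℚ)) :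
    ∃ N : ℕ, 0 < N ∧ ∀ n : ℕ, N ≤ n →
      rainbowIndex (completeMultipartiteGraph (fun _ : Fin r => Fin n)) k ℓ = k + 1 := by
  obtain ⟨a, b, ha, hbk, hb, hab⟩ := lower_arith k ℓ r hr hrk hℓ'
  have hq : 1 < (k + 1) ^ (k + 1) := Nat.one_lt_pow (by omega) (by omega)
  have hq1 : (1 : ℝ) < ((k + 1) ^ (k + 1) : ℕ) := by exact_mod_cast hq
  obtain ⟨N, hN⟩ := exists_threshold k ℓ r hℓ (1 - 1 / (((k + 1) ^ (k + 1) : ℕ) : ℝ))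
    (by rw [sub_pos, div_lt_one (by linarith)]; exact hq1)
    (by
      have : 0 < 1 / (((k + 1) ^ (k + 1) : ℕ) : ℝ) := by positivity
      linarith)
  refine ⟨N + k + 1, by omega, fun n hn => ?_⟩
  have hmem : k + 1 ∈ {t : ℕ | ∃ c : Sym2 (Σ _ : Fin r, Fin n) → Fin t,
      HasRainbowSTrees (completeMultipartiteGraph (fun _ : Fin r => Fin n)) c k ℓ} :=
    exists_coloring_s11 k ℓ r n (n / ℓ) _ ⟨0, by omega⟩ ⟨1, by omega⟩ (by simp)
      (Nat.mul_div_le n ℓ) rfl (hN n (by omega))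
  refine le_antisymm (Nat.sInf_le hmem) (le_csInf ⟨_, hmem⟩ ?_)
  rintro t ⟨c, hc⟩
  exact lower_bound k ℓ r n t a b hr hrk (by omega) ha hbk hb hab c hc
end

section
/- For each ℓ ∈ {1, 2, 3}, there exists a positive integer N = N(ℓ) such that for every integer n ≥ N, rx_{3,ℓ}(K_{n,n,n}) = 3, where K_{n,n,n} is the complete tripartite graph with three vertex classes each of size n. -/
open SimpleGraph

/-- Domination in the Paley tournament on 19 vertices (quadratic residues as a bit mask). -/
def paleyDom (a b : ℕ) : Bool := Nat.testBit 199410 ((a + 19 - b) % 19)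

theorem paleyDom_asymm : ∀ a < 19, ∀ b < 19, paleyDom a b = true → paleyDom b a = false := by
  decide +kernel

theorem paleyDom_three_zero : ∀ b < 19, ∀ c < 19, ∃ t < 19,
    paleyDom t 0 = true ∧ paleyDom t b = true ∧ paleyDom t c = true := by
  decide +kernel

theorem paleyDom_three : ∀ a < 19, ∀ b < 19, ∀ c < 19, ∃ t < 19,
    paleyDom t a = true ∧ paleyDom t b = true ∧ paleyDom t c = true := by
  intro a ha b hb c hc
  obtain ⟨t, ht, h0, h1, h2⟩ := paleyDom_three_zero ((b + 19 - a) % 19) (Nat.mod_lt _ (by norm_num))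
    ((c + 19 - a) % 19) (Nat.mod_lt _ (by norm_num))
  have key : ∀ d < 19, paleyDom ((t + a) % 19) d = paleyDom t ((d + 19 - a) % 19) := by
    intro d hd
    unfold paleyDom
    congr 1
    omega
  refine ⟨(t + a) % 19, Nat.mod_lt _ (by norm_num), ?_, ?_, ?_⟩
  · rw [key a ha]
    have : (a + 19 - a) % 19 = 0 := by omega
    rwa [this]
  · rwa [key b hb]
  · rwa [key c hc]

theorem bool_sep {D : ℕ} (x y z : Fin D → Bool) (hxy : x ≠ y) (hxz : x ≠ z) (hyz : y ≠ z) :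
    ∃ i j, (x i, x j) ≠ (y i, y j) ∧ (x i, x j) ≠ (z i, z j) ∧ (y i, y j) ≠ (z i, z j) := by
  obtain ⟨i, hi⟩ := Function.ne_iff.1 hxy
  by_cases h : z i = x i
  · obtain ⟨j, hj⟩ := Function.ne_iff.1 hxz
    refine ⟨i, j, ?_, ?_, ?_⟩ <;> simp only [ne_eq, Prod.mk.injEq, not_and] <;> intro h1 <;> grind
  · have h' : z i = y i := by
      cases hz : z i <;> cases hx : x i <;> cases hy : y i <;> simp_all
    obtain ⟨j, hj⟩ := Function.ne_iff.1 hyz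
    refine ⟨i, j, ?_, ?_, ?_⟩ <;> simp only [ne_eq, Prod.mk.injEq, not_and] <;> intro h1 <;> grind

/-- A covering array of strength three with few rows. -/
theorem covering_array (V : Type) [Fintype V] (D : ℕ) (hD : Fintype.card V ≤ 2 ^ D) :
    ∃ R : ℕ → V → Fin 3, ∀ x y z : V, x ≠ y → x ≠ z → y ≠ z → ∀ (a b c : Fin 3) (r : ℕ), r < 3 →
      ∃ s < 243 * D ^ 2, s % 3 = r ∧ R s x = a ∧ R s y = b ∧ R s z = c := by
  classical
  obtain ⟨f⟩ : Nonempty (V ↪ (Fin D → Bool)) := by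
    apply Function.Embedding.nonempty_of_card_le
    simpa using hD
  let ρ := Fin D × Fin D × (Bool × Bool → Fin 3)
  have hρ : Fintype.card ρ = 81 * D ^ 2 := by
    simp [ρ]; ring
  let e : ρ ≃ Fin (81 * D ^ 2) := Fintype.equivFinOfCardEq hρ
  refine ⟨fun s x => if h : s / 3 < 81 * D ^ 2 then
    (e.symm ⟨s / 3, h⟩).2.2 (f x (e.symm ⟨s / 3, h⟩).1, f x (e.symm ⟨s / 3, h⟩).2.1) else 0, ?_⟩
  intro x y z hxy hxz hyz a b c r hr
  obtain ⟨i, j, h1, h2, h3⟩ := bool_sep (f x) (f y) (f z) (f.injective.ne hxy)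
    (f.injective.ne hxz) (f.injective.ne hyz)
  let g : Bool × Bool → Fin 3 := fun q =>
    if q = (f x i, f x j) then a else if q = (f y i, f y j) then b else c
  have hlt := (e (i, j, g)).2
  have hdiv : (3 * (e (i, j, g)).1 + r) / 3 = (e (i, j, g)).1 := by omega
  have hs : ∀ h, e.symm ⟨(3 * (e (i, j, g)).1 + r) / 3, h⟩ = (i, j, g) := by
    intro h
    rw [Equiv.symm_apply_eq]
    exact Fin.ext hdiv
  refine ⟨3 * (e (i, j, g)).1 + r, by omega, by omega, ?_, ?_, ?_⟩
  · simp only [hs]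
    rw [dif_pos (by omega)]
    simp [g]
  · simp only [hs]
    rw [dif_pos (by omega)]
    simp only [g]
    rw [if_neg h1.symm]; simp
  · simp only [hs]
    rw [dif_pos (by omega)]
    simp only [g]
    rw [if_neg h2.symm, if_neg h3.symm]

theorem exists_D : ∃ N : ℕ, 3 ≤ N ∧ ∀ n, N ≤ n → ∃ D, 3 * n ≤ 2 ^ D ∧ 19 * (243 * D ^ 2) ≤ n := by
  have key : ∀ L, 30 ≤ L → 19 * (243 * (L + 3) ^ 2) ≤ 2 ^ L := by
    intro L hL
    induction L, hL using Nat.le_induction with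
    | base => norm_num
    | succ L hL ih =>
      have h2 : 2 ^ (L + 1) = 2 * 2 ^ L := by ring
      rw [h2]
      nlinarith
  refine ⟨2 ^ 30, by norm_num, fun n hn => ⟨Nat.log 2 n + 3, ?_, ?_⟩⟩
  · have := Nat.lt_pow_succ_log_self (b := 2) (by norm_num) n
    rw [pow_add]
    rw [Nat.succ_eq_add_one, pow_succ] at this
    omega
  · have h0 : n ≠ 0 := by
      rintro rfl
      norm_num at hn
    exact (key _ (Nat.le_log_of_pow_le (by norm_num) hn)).trans (Nat.pow_log_le_self 2 h0)

abbrev KV (n : ℕ) := (_ : Fin 3) × Fin n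

theorem exists_coloring_s16 (n D : ℕ) (h1 : 3 * n ≤ 2 ^ D) (h2 : 19 * (243 * D ^ 2) ≤ n) :
    ∃ (col : Sym2 (KV n) → Fin 3) (tag : KV n → ℕ),
      ∀ (p : Fin 3) (x y z : KV n), x ≠ y → x ≠ z → y ≠ z → ∀ (a b c : Fin 3) (r : ℕ), r < 3 →
        ∃ w : KV n, w.1 = p ∧ tag w = r ∧ col s(w, x) = a ∧ col s(w, y) = b ∧ col s(w, z) = c := by
  obtain ⟨R, hR⟩ := covering_array (KV n) D (by simpa using h1)
  let F : KV n → KV n → Fin 3 := fun v w =>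
    if paleyDom (v.2.1 % 19) (w.2.1 % 19) = true then R (v.2.1 / 19) w
    else if paleyDom (w.2.1 % 19) (v.2.1 % 19) = true then R (w.2.1 / 19) v else 0
  have hF : ∀ v w, F v w = F w v := by
    intro v w
    have := paleyDom_asymm (v.2.1 % 19) (Nat.mod_lt _ (by norm_num)) (w.2.1 % 19)
      (Nat.mod_lt _ (by norm_num))
    simp only [F]
    split_ifs <;> simp_all
  refine ⟨Sym2.lift ⟨F, hF⟩, fun v => v.2.1 / 19 % 3, ?_⟩
  intro p x y z hxy hxz hyz a b c r hr
  obtain ⟨s, hs, hsr, hx, hy, hz⟩ := hR x y z hxy hxz hyz a b c r hr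
  obtain ⟨t, ht, tx, ty, tz⟩ := paleyDom_three (x.2.1 % 19) (Nat.mod_lt _ (by norm_num))
    (y.2.1 % 19) (Nat.mod_lt _ (by norm_num)) (z.2.1 % 19) (Nat.mod_lt _ (by norm_num))
  have e1 : (19 * s + t) % 19 = t := by omega
  have e2 : (19 * s + t) / 19 = s := by omega
  refine ⟨⟨p, ⟨19 * s + t, by omega⟩⟩, rfl, ?_, ?_, ?_, ?_⟩
  · simp only [e2, hsr]
  · simp only [Sym2.lift_mk, F, e1, e2, tx, if_true, hx]
  · simp only [Sym2.lift_mk, F, e1, e2, ty, if_true, hy]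
  · simp only [Sym2.lift_mk, F, e1, e2, tz, if_true, hz]

/-- The two trees on four vertices. -/
def fourTree (k : Fin 4) : SimpleGraph (Fin 4) := SimpleGraph.fromEdgeSet {s(0, 1), s(0, 2), s(k, 3)}

theorem fourTree_isTree (k : Fin 4) (hk : k = 0 ∨ k = 1) : (fourTree k).IsTree := by
  have h01 : (fourTree k).Adj 0 1 := by simp [fourTree]
  have h02 : (fourTree k).Adj 0 2 := by simp [fourTree]
  have hk3 : (fourTree k).Adj k 3 := by rcases hk with rfl | rfl <;> simp [fourTree]
  have hr : ∀ v, (fourTree k).Reachable 0 v := by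
    intro v
    fin_cases v
    · exact SimpleGraph.Reachable.rfl
    · exact h01.reachable
    · exact h02.reachable
    · rcases hk with rfl | rfl
      · exact hk3.reachable
      · exact h01.reachable.trans hk3.reachable
  have hE : (fourTree k).edgeSet = (({s(0, 1), s(0, 2), s(k, 3)} : Finset (Sym2 (Fin 4))) : Set _) := by
    rw [fourTree, SimpleGraph.edgeSet_fromEdgeSet]
    ext e
    simp only [Set.mem_sdiff, Finset.coe_insert, Finset.coe_singleton]
    constructor
    · exact fun h => h.1
    · intro h
      refine ⟨h, ?_⟩
      rcases hk with rfl | rfl <;> rcases h with rfl | rfl | rfl <;> simp [Sym2.diagSet]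
  rw [SimpleGraph.isTree_iff_connected_and_card]
  refine ⟨⟨fun u v => (hr u).symm.trans (hr v)⟩, ?_⟩
  rw [hE, Nat.card_coe_set_eq, Set.ncard_coe_finset, Nat.card_eq_fintype_card]
  rcases hk with rfl | rfl <;> decide

theorem tree_exists {V : Type*} (G : SimpleGraph V) (f : Fin 4 → V) (hf : Function.Injective f)
    (k : Fin 4) (hk : k = 0 ∨ k = 1) (h1 : G.Adj (f 0) (f 1)) (h2 : G.Adj (f 0) (f 2))
    (h3 : G.Adj (f k) (f 3)) :
    ∃ T : G.Subgraph, T.verts = Set.range f ∧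
      T.edgeSet ⊆ {s(f 0, f 1), s(f 0, f 2), s(f k, f 3)} ∧ T.coe.IsTree := by
  let φ : fourTree k →g G := ⟨f, by
    intro a b hab
    have hab' : s(a, b) ∈ ({s(0, 1), s(0, 2), s(k, 3)} : Set (Sym2 (Fin 4))) := hab.1
    simp only [Set.mem_insert_iff, Set.mem_singleton_iff, Sym2.eq_iff] at hab'
    rcases hab' with (⟨rfl, rfl⟩ | ⟨rfl, rfl⟩) | (⟨rfl, rfl⟩ | ⟨rfl, rfl⟩) | (⟨rfl, rfl⟩ | ⟨rfl, rfl⟩)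
    exacts [h1, h1.symm, h2, h2.symm, h3, h3.symm]⟩
  let C : SimpleGraph.Copy (fourTree k) G := ⟨φ, hf⟩
  refine ⟨C.toSubgraph, ?_, ?_, ?_⟩
  · simp [SimpleGraph.Copy.toSubgraph, C, φ]
  · rw [SimpleGraph.Copy.toSubgraph, SimpleGraph.Subgraph.edgeSet_map]
    rintro _ ⟨e, he, rfl⟩
    have he' : e ∈ (fourTree k).edgeSet := by simpa using he
    rw [fourTree, SimpleGraph.edgeSet_fromEdgeSet] at he'
    rcases he'.1 with rfl | rfl | rfl
    · exact Or.inl rfl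
    · exact Or.inr (Or.inl rfl)
    · exact Or.inr (Or.inr rfl)
  · exact (C.isoToSubgraph.isTree_iff).1 (fourTree_isTree k hk)

/-- Assembling a family of three internally disjoint rainbow trees. -/
theorem family_of {V : Type*} (G : SimpleGraph V) (col : Sym2 V → Fin 3) (S : Set V)
    (f : Fin 3 → Fin 4 → V) (hf : ∀ i, Function.Injective (f i)) (hS : ∀ i, f i '' {1, 2, 3} = S)
    (k : Fin 4) (hk : k = 0 ∨ k = 1) (hw : Function.Injective fun i => f i 0)
    (h1 : ∀ i, G.Adj (f i 0) (f i 1)) (h2 : ∀ i, G.Adj (f i 0) (f i 2))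
    (h3 : ∀ i, G.Adj (f i k) (f i 3))
    (hdis : k = 1 → Function.Injective fun i => s(f i 1, f i 3))
    (c12 : ∀ i, col s(f i 0, f i 1) ≠ col s(f i 0, f i 2))
    (c13 : ∀ i, col s(f i 0, f i 1) ≠ col s(f i k, f i 3))
    (c23 : ∀ i, col s(f i 0, f i 2) ≠ col s(f i k, f i 3)) :
    ∃ T : Fin 3 → G.Subgraph, (∀ i, IsRainbowSTree G col S (T i)) ∧ InternallyDisjoint S T := by
  choose T hT1 hT2 hT3 using fun i => tree_exists G (f i) (hf i) k hk (h1 i) (h2 i) (h3 i)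
  have hrange : ∀ i, Set.range (f i) = insert (f i 0) S := by
    intro i
    rw [← hS i, ← Set.image_insert_eq, ← Set.image_univ]
    congr 1
    ext a
    fin_cases a <;> simp
  have hmem : ∀ i (a : Fin 4), a ≠ 0 → f i a ∈ S := by
    intro i a ha
    rw [← hS i]
    refine ⟨a, ?_, rfl⟩
    fin_cases a <;> simp_all
  have hnot : ∀ i, f i 0 ∉ S := by
    intro i h
    rw [← hS i] at h
    obtain ⟨a, ha, h⟩ := h
    have := hf i h
    subst this
    simp at ha
  refine ⟨T, fun i => ⟨?_, hT3 i, ?_⟩, fun i j hij => ⟨?_, ?_⟩⟩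
  · rw [hT1, hrange]
    exact Set.subset_insert _ _
  · intro a ha b hb hab
    have a1 := c12 i
    have a2 := c13 i
    have a3 := c23 i
    rcases hT2 i ha with rfl | rfl | rfl <;> rcases hT2 i hb with rfl | rfl | rfl <;> first
      | rfl
      | exact absurd hab (by assumption)
      | exact absurd hab.symm (by assumption)
  · have hw' : f i 0 ≠ f j 0 := fun h => hij (hw h)
    have key : ∀ a b : Fin 4, a ≠ 0 → s(f i 0, f i a) ∉ (T j).edgeSet := by
      intro a b ha h
      have hv : f i 0 ∈ (T j).verts := (T j).mem_verts_of_mem_edge h (by simp)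
      rw [hT1, hrange] at hv
      rcases hv with hv | hv
      · exact hw' hv
      · exact hnot i hv
    rw [Set.eq_empty_iff_forall_notMem]
    rintro e ⟨he, he'⟩
    rcases hT2 i he with rfl | rfl | rfl
    · exact key 1 0 (by decide) he'
    · exact key 2 0 (by decide) he'
    · rcases hk with rfl | rfl
      · exact key 3 0 (by decide) he'
      · have m1 := hmem i 1 (by decide)
        have m3 := hmem i 3 (by decide)
        have n0 := hnot j
        rcases hT2 j he' with h | h | h
        · rcases Sym2.eq_iff.1 h with h | h
          · exact n0 (h.1 ▸ m1)
          · exact n0 (h.2 ▸ m3)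
        · rcases Sym2.eq_iff.1 h with h | h
          · exact n0 (h.1 ▸ m1)
          · exact n0 (h.2 ▸ m3)
        · exact hij (hdis rfl h)
  · rw [hT1, hT1, hrange, hrange]
    ext v
    simp only [Set.mem_inter_iff, Set.mem_insert_iff]
    constructor
    · rintro ⟨h | h, h' | h'⟩
      · exact absurd (hw (h.symm.trans h')) hij
      all_goals assumption
    · exact fun h => ⟨Or.inr h, Or.inr h⟩

abbrev KG (n : ℕ) : SimpleGraph (KV n) := completeMultipartiteGraph (fun _ : Fin 3 => Fin n)

theorem KG_adj {n : ℕ} (v w : KV n) : (KG n).Adj v w ↔ v.1 ≠ w.1 := Iff.rfl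

theorem inj_four {V : Type*} (a b c d : V) (h1 : a ≠ b) (h2 : a ≠ c) (h3 : a ≠ d) (h4 : b ≠ c)
    (h5 : b ≠ d) (h6 : c ≠ d) : Function.Injective ![a, b, c, d] := by
  intro i j h
  fin_cases i <;> fin_cases j <;> simp_all

theorem upper_three (n D : ℕ) (h1 : 3 * n ≤ 2 ^ D) (h2 : 19 * (243 * D ^ 2) ≤ n) :
    ∃ col : Sym2 (KV n) → Fin 3, HasRainbowSTrees (KG n) col 3 3 := by
  classical
  obtain ⟨col, tag, H⟩ := exists_coloring_s16 n D h1 h2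
  refine ⟨col, fun S hS => ?_⟩
  obtain ⟨x, y, z, hxy, hxz, hyz, rfl⟩ := Finset.card_eq_three.1 hS
  by_cases hp : ∃ p : Fin 3, p ≠ x.1 ∧ p ≠ y.1 ∧ p ≠ z.1
  · obtain ⟨p, px, py, pz⟩ := hp
    choose w hw1 hw2 hwx hwy hwz using fun i : Fin 3 => H p x y z hxy hxz hyz 0 1 2 i.1 i.2
    refine family_of (KG n) col _ (fun i => ![w i, x, y, z]) ?_ ?_ 0 (Or.inl rfl) ?_ ?_ ?_ ?_ ?_ ?_ ?_ ?_
    · intro i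
      apply inj_four _ _ _ _ _ _ _ hxy hxz hyz
      · rintro rfl; exact px (hw1 i).symm
      · rintro rfl; exact py (hw1 i).symm
      · rintro rfl; exact pz (hw1 i).symm
    · intro i
      simp [Set.image_insert_eq]
    · intro i j hij
      have hij' : w i = w j := hij
      have := hw2 i
      rw [hij', hw2 j] at this
      exact Fin.ext this.symm
    · intro i; rw [KG_adj]; simpa [hw1 i] using px
    · intro i; rw [KG_adj]; simpa [hw1 i] using py
    · intro i; rw [KG_adj]; simpa [hw1 i] using pz
    · intro h; simp at h
    · intro i; simp [hwx, hwy]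
    · intro i; simp [hwx, hwz]
    · intro i; simp [hwy, hwz]
  · push Not at hp
    have hsurj : ∀ p : Fin 3, ∃ v : KV n, v ∈ ({x, y, z} : Finset (KV n)) ∧ v.1 = p := by
      intro p
      by_cases e1 : p = x.1
      · exact ⟨x, by simp, e1.symm⟩
      by_cases e2 : p = y.1
      · exact ⟨y, by simp, e2.symm⟩
      · exact ⟨z, by simp, (hp p e1 e2).symm⟩
    choose v hv hvp using hsurj
    have vinj : Function.Injective v := fun i j h => by rw [← hvp i, h, hvp j]
    have hSv : ({x, y, z} : Finset (KV n)) = Finset.univ.image v := by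
      symm
      apply Finset.eq_of_subset_of_card_le
      · intro a ha
        obtain ⟨i, -, rfl⟩ := Finset.mem_image.1 ha
        exact hv i
      · rw [hS, Finset.card_image_of_injective _ vinj]; simp
    rw [hSv]
    have ne01 : ∀ i : Fin 3, i ≠ i + 1 := by decide
    have ne02 : ∀ i : Fin 3, i ≠ i + 2 := by decide
    have ne12 : ∀ i : Fin 3, i + 1 ≠ i + 2 := by decide
    choose w hw1 hw2 hwx hwy hwz using fun i : Fin 3 =>
      H i (v (i + 1)) (v (i + 2)) (v i) (vinj.ne (ne12 i)) (vinj.ne (ne01 i).symm)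
        (vinj.ne (ne02 i).symm) (col s(v (i + 1), v i) + 1) (col s(v (i + 1), v i) + 2) 0
        ((tag (v i) + 1) % 3) (Nat.mod_lt _ (by norm_num))
    have hwv : ∀ i j, w i ≠ v j := by
      intro i j h
      have hij : i = j := by rw [← hw1 i, h, hvp j]
      subst hij
      have := hw2 i
      rw [h] at this
      omega
    refine family_of (KG n) col _ (fun i => ![w i, v (i + 1), v (i + 2), v i]) ?_ ?_ 1 (Or.inr rfl)
      ?_ ?_ ?_ ?_ ?_ ?_ ?_ ?_
    · intro i
      exact inj_four _ _ _ _ (hwv _ _) (hwv _ _) (hwv _ _) (vinj.ne (ne12 i))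
        (vinj.ne (ne01 i).symm) (vinj.ne (ne02 i).symm)
    · intro i
      ext a
      simp only [Set.image_insert_eq, Set.image_singleton, Finset.coe_image, Finset.coe_univ,
        Set.image_univ, Set.mem_range, Set.mem_insert_iff, Set.mem_singleton_iff]
      constructor
      · rintro (h | h | h)
        · exact ⟨i + 1, h.symm⟩
        · exact ⟨i + 2, h.symm⟩
        · exact ⟨i, h.symm⟩
      · rintro ⟨j, rfl⟩
        have : ∀ i j : Fin 3, j = i + 1 ∨ j = i + 2 ∨ j = i := by decide
        rcases this i j with rfl | rfl | rfl
        · exact Or.inl rfl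
        · exact Or.inr (Or.inl rfl)
        · exact Or.inr (Or.inr rfl)
    · intro i j hij
      have hij' : w i = w j := hij
      rw [← hw1 i, hij', hw1 j]
    · intro i; rw [KG_adj]; simp [hw1 i, hvp]
    · intro i; rw [KG_adj]; simp [hw1 i, hvp]
    · intro i; rw [KG_adj]; simp [hvp]
    · intro _ i j hij
      have hij' : s(v (i + 1), v i) = s(v (j + 1), v j) := hij
      have : ∀ i j : Fin 3, i + 1 = j → i = j + 1 → i = j := by decide
      rcases Sym2.eq_iff.1 hij' with h | h
      · exact vinj h.2
      · exact this i j (vinj h.1) (vinj h.2)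
    · intro i
      have : ∀ q : Fin 3, q + 1 ≠ q + 2 := by decide
      simp only [Matrix.cons_val]
      rw [hwx, hwy]; exact this _
    · intro i
      have : ∀ q : Fin 3, q + 1 ≠ q := by decide
      simp only [Matrix.cons_val]
      rw [hwx]; exact this _
    · intro i
      have : ∀ q : Fin 3, q + 2 ≠ q := by decide
      simp only [Matrix.cons_val]
      rw [hwy]; exact this _

theorem lower_three_s16 (n ℓ t : ℕ) (hn : 3 ≤ n) (hℓ : 1 ≤ ℓ) (col : Sym2 (KV n) → Fin t)
    (h : HasRainbowSTrees (KG n) col 3 ℓ) : 3 ≤ t := by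
  classical
  let v : Fin 3 → KV n := fun i => ⟨0, Fin.castLE hn i⟩
  have vinj : Function.Injective v := by
    intro i j hij
    simpa [v] using hij
  obtain ⟨T, hT, -⟩ := h (Finset.univ.image v) (by
    rw [Finset.card_image_of_injective _ vinj]; simp)
  obtain ⟨hS, htree, hinj⟩ := hT ⟨0, hℓ⟩
  have hv : ∀ i, v i ∈ (T ⟨0, hℓ⟩).verts := fun i => hS (by simp)
  have hnb : ∀ i, ∃ y, (T ⟨0, hℓ⟩).Adj (v i) y := by
    intro i
    have : Nontrivial (T ⟨0, hℓ⟩).verts :=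
      ⟨⟨⟨v 0, hv 0⟩, ⟨v 1, hv 1⟩, fun h => by
        have := vinj (congrArg Subtype.val h)
        simp at this⟩⟩
    obtain ⟨y, hy⟩ := htree.connected.preconnected.exists_adj_of_nontrivial ⟨v i, hv i⟩
    exact ⟨y.1, hy⟩
  choose y hy using hnb
  have hi : Function.Injective fun i => col s(v i, y i) := by
    intro i j hij
    have := hinj (hy i) (hy j) hij
    rcases Sym2.eq_iff.1 this with h | h
    · exact vinj h.1
    · have hadj := (KG_adj _ _).1 (hy j).adj_sub
      rw [← h.1] at hadj
      exact absurd rfl hadj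
  simpa using Fintype.card_le_of_injective _ hi

theorem rx3l_Knnn_eq_three (ℓ : ℕ) (hℓ : ℓ = 1 ∨ ℓ = 2 ∨ ℓ = 3) :
    ∃ N : ℕ, 0 < N ∧ ∀ n : ℕ, N ≤ n →
      rainbowIndex (completeMultipartiteGraph (fun _ : Fin 3 => Fin n)) 3 ℓ = 3 := by
  obtain ⟨N, hN, H⟩ := exists_D
  refine ⟨N, by omega, fun n hn => ?_⟩
  obtain ⟨D, h1, h2⟩ := H n hn
  obtain ⟨col, hcol⟩ := upper_three n D h1 h2
  have hle : ℓ ≤ 3 := by omega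
  have hmem : 3 ∈ {t : ℕ | ∃ c : Sym2 (KV n) → Fin t, HasRainbowSTrees (KG n) c 3 ℓ} := by
    refine ⟨col, fun S hS => ?_⟩
    obtain ⟨T, hT1, hT2⟩ := hcol S hS
    exact ⟨fun i => T (Fin.castLE hle i), fun i => hT1 _, fun i j hij =>
      hT2 _ _ (fun h => hij (Fin.castLE_injective hle h))⟩
  apply le_antisymm
  · exact Nat.sInf_le hmem
  · refine le_csInf ⟨3, hmem⟩ ?_
    rintro t ⟨c, hc⟩
    exact lower_three_s16 n ℓ t (by omega) (by omega) c hc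
end
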